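/- arXiv:1606.03862 — 3 statements merged into one kernel-verified Lean document; each statement's English description precedes it below -/
import Mathlib

section
/- Let M be a finitely generated conical refinement monoid which is a graph monoid, and let p be a free prime of M which is not minimal in the poset of primes of M. Then for a Grothendieck group ι : M_{J_p} → G(M_{J_p}), the unique group homomorphism G(φ_p) : G(M_{J_p}) → G'_p satisfying G(φ_p) ∘ ι = φ_p is surjective and its kernel equals the cyclic subgroup of G(M_{J_p}) generated by ι(x) for some x ∈ M_{J_p}. -/
namespace ArPardo

/-- A countable row-finite directed graph `E = (E⁰, E¹, s, r)`. -/
structure RowFiniteGraph : Type 1 where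
  V : Type
  E : Type
  countableV : Countable V
  countableE : Countable E
  s : E → V
  r : E → V
  rowFinite : ∀ v : V, {e : E | s e = v}.Finite

/-- The defining relations of the graph monoid, as a relation on the free
commutative monoid `V →₀ ℕ` on the vertices: for every vertex `v` emitting
at least one edge, `a_v = Σ_{e ∈ s⁻¹(v)} a_{r(e)}`. -/
def graphRel (G : RowFiniteGraph) (x y : G.V →₀ ℕ) : Prop :=
  ∃ v : G.V, (∃ e : G.E, G.s e = v) ∧ x = Finsupp.single v 1 ∧
    y = ∑ e ∈ (G.rowFinite v).toFinset, Finsupp.single (G.r e) 1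

/-- The graph monoid `M(E)`: the quotient of the free commutative monoid on the
vertices by the congruence generated by the graph relations. -/
def graphMonoid (G : RowFiniteGraph) : Type :=
  (addConGen (graphRel G)).Quotient

noncomputable instance (G : RowFiniteGraph) : AddCommMonoid (graphMonoid G) :=
  inferInstanceAs (AddCommMonoid (addConGen (graphRel G)).Quotient)

/-- The canonical generator `a_v` of the graph monoid. -/
noncomputable def vertexElem (G : RowFiniteGraph) (v : G.V) : graphMonoid G :=
  (addConGen (graphRel G)).mk' (Finsupp.single v 1)

/-- A commutative monoid is a graph monoid if it is isomorphic to `M(E)` for some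
(countable) row-finite directed graph `E`. -/
def IsGraphMonoid (M : Type) [AddCommMonoid M] : Prop :=
  ∃ G : RowFiniteGraph, Nonempty (M ≃+ graphMonoid G)

/-- The algebraic preorder on a commutative monoid: `x ≤ y` iff `y = x + z`. -/
def algLE {M : Type} [AddCommMonoid M] (x y : M) : Prop :=
  ∃ z : M, y = x + z

/-- A commutative monoid is conical if `x + y = 0` implies `x = y = 0`. -/
def IsConical (M : Type) [AddCommMonoid M] : Prop :=
  ∀ x y : M, x + y = 0 → x = 0 ∧ y = 0

/-- The Riesz refinement property. -/
def IsRefinement (M : Type) [AddCommMonoid M] : Prop :=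
  ∀ a b c d : M, a + b = c + d →
    ∃ w x y z : M, a = w + x ∧ b = y + z ∧ c = w + y ∧ d = x + z

/-- A prime element: not invertible, and `p ≤ a + b` implies `p ≤ a` or `p ≤ b`. -/
def IsPrimeElem {M : Type} [AddCommMonoid M] (p : M) : Prop :=
  (∀ q : M, p + q ≠ 0) ∧ ∀ a b : M, algLE p (a + b) → algLE p a ∨ algLE p b

/-- A free element: `n • p ≤ m • p` implies `n ≤ m`. -/
def IsFreeElem {M : Type} [AddCommMonoid M] (p : M) : Prop :=
  ∀ n m : ℕ, algLE (n • p) (m • p) → n ≤ m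

/-- A regular element: `2x ≤ x`. -/
def IsRegularElem {M : Type} [AddCommMonoid M] (x : M) : Prop :=
  algLE (x + x) x

/-- `q̄ < p̄` in the poset of (classes of) elements: `q ≤ p` and `p ≰ q`. -/
def classLT {M : Type} [AddCommMonoid M] (q p : M) : Prop :=
  algLE q p ∧ ¬ algLE p q

/-- `q` is a prime whose class lies in the lower cover of the class of the prime `p`:
`q̄ < p̄` and no prime class lies strictly between. -/
def InLowerCover {M : Type} [AddCommMonoid M] (p q : M) : Prop :=
  IsPrimeElem q ∧ classLT q p ∧
    ¬ ∃ t : M, IsPrimeElem t ∧ classLT q t ∧ classLT t p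

/-- `Q` is a (finite) set of representatives of the classes in the lower cover of `p̄`:
its elements are in the lower cover, pairwise inequivalent, and every prime in the
lower cover is equivalent to one of them. -/
def IsLowerCoverReps {M : Type} [AddCommMonoid M] (p : M) (Q : Finset M) : Prop :=
  (∀ q ∈ Q, InLowerCover p q) ∧
  (∀ q ∈ Q, ∀ q' ∈ Q, algLE q q' → algLE q' q → q = q') ∧
  (∀ t : M, InLowerCover p t → ∃ q ∈ Q, algLE q t ∧ algLE t q)

/-- The underlying set of the group `G'_p = {p + α : α ∈ M, p + α ≤ p}`. -/
def GpSet {M : Type} [AddCommMonoid M] (p : M) : Set M :=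
  {y | ∃ α : M, y = p + α ∧ algLE y p}

/-- `j : G' → M` realizes the abelian group `G'` as the group
`G'_p = {p + α : p + α ≤ p}` with identity `p` and operation
`(p + α) ∘ (p + β) = p + (α + β)`. -/
structure GpStructure (M : Type) [AddCommMonoid M] (p : M)
    (G' : Type) [AddCommGroup G'] (j : G' → M) : Prop where
  inj : Function.Injective j
  range_eq : Set.range j = GpSet p
  map_zero : j 0 = p
  map_add : ∀ (u v : G') (α β : M), j u = p + α → j v = p + β → j (u + v) = p + (α + β)

/-- The archimedean component of `s`: all `a` with `a ≤ n • s` and `s ≤ m • a` for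
some positive integers `n, m`; it is a subsemigroup. -/
def archComp {M : Type} [AddCommMonoid M] (s : M) : AddSubsemigroup M where
  carrier := {a : M | ∃ n m : ℕ, 0 < n ∧ 0 < m ∧ algLE a (n • s) ∧ algLE s (m • a)}
  add_mem' := by
    rintro a b ⟨n, m, hn, hm, ⟨z, hz⟩, ⟨w, hw⟩⟩ ⟨n', m', hn', hm', ⟨z', hz'⟩, ⟨w', hw'⟩⟩
    refine ⟨n + n', m, Nat.add_pos_left hn _, hm, ⟨z + z', ?_⟩, ⟨w + m • b, ?_⟩⟩
    · rw [add_nsmul, hz, hz']; abel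
    · rw [nsmul_add, hw]; abel

/-- `(Γ, ι)` is a Grothendieck group of the commutative semigroup `S`: every
semigroup homomorphism from `S` to an abelian group factors uniquely through `ι`. -/
def IsGrothendieck (S : Type) [Add S] (Γ : Type) [AddCommGroup Γ] (ι : AddHom S Γ) : Prop :=
  ∀ (A : Type) [AddCommGroup A], ∀ f : AddHom S A, ∃! g : Γ →+ A, ∀ x : S, g (ι x) = f x

/-- The almost-isomorphism condition at a free prime `p`, with `Q` a set of
representatives of the lower cover of `p̄`, and `s_p = Σ_{q ∈ Q} q`: for every
Grothendieck group `ι : M_{J_p} → Γ` of the archimedean component `M_{J_p}` of `s_p`,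
every realization `(G', j)` of the group `G'_p`, every incarnation
`φp : M_{J_p} → G'` of the map `x ↦ p + x`, the unique group homomorphism
`ψ = G(φ_p) : Γ → G'` with `ψ ∘ ι = φp` is surjective and its kernel is the cyclic
subgroup generated by `ι x` for some `x ∈ M_{J_p}`. -/
def AlmostIsoCondition (M : Type) [AddCommMonoid M] (p : M) (Q : Finset M) : Prop :=
  ∀ (Γ : Type) [AddCommGroup Γ],
    ∀ ι : AddHom (archComp (∑ q ∈ Q, (q : M))) Γ,
    IsGrothendieck (archComp (∑ q ∈ Q, (q : M))) Γ ι →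
    ∀ (G' : Type) [AddCommGroup G'], ∀ j : G' → M, GpStructure M p G' j →
    ∀ φp : AddHom (archComp (∑ q ∈ Q, (q : M))) G',
      (∀ a : archComp (∑ q ∈ Q, (q : M)), j (φp a) = p + (a : M)) →
    ∀ ψ : Γ →+ G', (∀ a, ψ (ι a) = φp a) →
      Function.Surjective ψ ∧
        ∃ x : archComp (∑ q ∈ Q, (q : M)), ψ.ker = AddSubgroup.zmultiples (ι x)

/-- An order-ideal of a commutative monoid. -/
def IsOrderIdeal {M : Type} [AddCommMonoid M] (S : Set M) : Prop :=
  (0 : M) ∈ S ∧ (∀ x y : M, x ∈ S → y ∈ S → x + y ∈ S) ∧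
    ∀ x y : M, algLE x y → y ∈ S → x ∈ S

/-- The order-ideal generated by a subset: the smallest order-ideal containing it. -/
def orderIdealGen {M : Type} [AddCommMonoid M] (X : Set M) : Set M :=
  ⋂₀ {S : Set M | IsOrderIdeal S ∧ X ⊆ S}

/-- The restriction graph `E_H` of a hereditary subset `H` of the vertices. -/
def restrictGraph (G : RowFiniteGraph) (H : Set G.V)
    (hher : ∀ e : G.E, G.s e ∈ H → G.r e ∈ H) : RowFiniteGraph where
  V := ↥H
  E := {e : G.E // G.s e ∈ H}
  countableV := by have := G.countableV; exact inferInstance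
  countableE := by have := G.countableE; exact inferInstance
  s := fun e => ⟨G.s e.1, e.2⟩
  r := fun e => ⟨G.r e.1, hher e.1 e.2⟩
  rowFinite := fun v => by
    have hsub : {e : {e : G.E // G.s e ∈ H} | (⟨G.s e.1, e.2⟩ : ↥H) = v}
        ⊆ Subtype.val ⁻¹' {e : G.E | G.s e = (v : G.V)} := by
      intro e he
      simpa [Subtype.ext_iff] using he
    exact Set.Finite.subset
      (Set.Finite.preimage (Subtype.val_injective.injOn) (G.rowFinite (v : G.V))) hsub

section Order

variable {M : Type} [AddCommMonoid M]

theorem algLE.refl (x : M) : algLE x x := ⟨0, by simp⟩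

theorem algLE.trans {x y z : M} : algLE x y → algLE y z → algLE x z := by
  rintro ⟨a, rfl⟩ ⟨b, rfl⟩
  exact ⟨a + b, by abel⟩

theorem algLE.add {x y x' y' : M} : algLE x y → algLE x' y' → algLE (x + x') (y + y') := by
  rintro ⟨a, rfl⟩ ⟨b, rfl⟩
  exact ⟨a + b, by abel⟩

theorem algLE_add_right (x y : M) : algLE x (x + y) := ⟨y, rfl⟩

theorem algLE_add_left (x y : M) : algLE x (y + x) := ⟨y, add_comm y x⟩

theorem zero_algLE (x : M) : algLE 0 x := ⟨x, by simp⟩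

theorem algLE.not_of_isFreeElem {p : M} (hfree : IsFreeElem p) : ¬ algLE (p + p) p := by
  intro h
  have := hfree 2 1 (by simpa [two_nsmul] using h)
  omega

instance : IsPreorder M (algLE (M := M)) where
  refl := algLE.refl
  trans _ _ _ := algLE.trans

theorem IsPrimeElem.not_algLE_zero {p : M} (hp : IsPrimeElem p) : ¬ algLE p 0 :=
  fun ⟨z, hz⟩ => hp.1 z hz.symm

theorem IsPrimeElem.not_algLE_add {p x y : M} (hp : IsPrimeElem p) (hx : ¬ algLE p x)
    (hy : ¬ algLE p y) : ¬ algLE p (x + y) :=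
  fun h => (hp.2 x y h).elim hx hy

theorem IsPrimeElem.exists_mem_algLE_of_closure {p : M} (hp : IsPrimeElem p) {S : Set M} {x : M}
    (hx : x ∈ AddSubmonoid.closure S) : algLE p x → ∃ g ∈ S, algLE p g ∧ algLE g x := by
  induction hx using AddSubmonoid.closure_induction with
  | mem g hg => exact fun h => ⟨g, hg, h, algLE.refl g⟩
  | zero => exact fun h => absurd h hp.not_algLE_zero
  | add a b _ _ iha ihb =>
    intro h
    rcases hp.2 a b h with h | h
    · obtain ⟨g, hg, h1, h2⟩ := iha h
      exact ⟨g, hg, h1, h2.trans (algLE_add_right a b)⟩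
    · obtain ⟨g, hg, h1, h2⟩ := ihb h
      exact ⟨g, hg, h1, h2.trans (algLE_add_left b a)⟩

/-- Dickson's lemma for the algebraic preorder of a finitely generated commutative monoid. -/
theorem wellQuasiOrdered_algLE [AddMonoid.FG M] : WellQuasiOrdered (algLE (M := M)) := by
  obtain ⟨S, hS⟩ := AddMonoid.FG.fg_top (M := M)
  have key (x : M) : ∃ a : S → ℕ, x = ∑ i : S, a i • i.1 :=
    AddSubmonoid.mem_closure_finset'.1 (by simp [hS])
  choose c hc using key
  intro f
  obtain ⟨m, n, hmn, h⟩ := wellQuasiOrdered_le (α := S → ℕ) (fun i => c (f i))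
  refine ⟨m, n, hmn, ∑ i : S, (c (f n) i - c (f m) i) • i.1, ?_⟩
  calc f n = ∑ i : S, c (f n) i • i.1 := hc (f n)
    _ = ∑ i : S, c (f m) i • i.1 + ∑ i : S, (c (f n) i - c (f m) i) • i.1 := by
      rw [← Finset.sum_add_distrib]
      refine Finset.sum_congr rfl fun i _ => ?_
      rw [← add_nsmul, Nat.add_sub_cancel' (h i)]
    _ = _ := by rw [← hc (f m)]

/-- In a finitely generated refinement monoid, an element outside an order-ideal lies above a prime
outside that order-ideal. -/
theorem exists_isPrimeElem_notMem_of_notMem [AddMonoid.FG M] (href : IsRefinement M) {I : Set M}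
    (hI : IsOrderIdeal I) {a : M} (ha : a ∉ I) : ∃ u, IsPrimeElem u ∧ u ∉ I ∧ algLE u a := by
  obtain ⟨u, ⟨huI, hua⟩, hmin⟩ := (wellQuasiOrdered_algLE (M := M)).wellFounded.has_min
    {x | x ∉ I ∧ algLE x a} ⟨a, ha, algLE.refl a⟩
  have hmin' (x : M) (hx : x ∉ I) (hxu : algLE x u) : algLE u x := by
    by_contra h
    exact hmin x ⟨hx, hxu.trans hua⟩ ⟨hxu, h⟩
  refine ⟨u, ⟨fun q hq => huI (hI.2.2 u 0 ⟨q, hq.symm⟩ hI.1), fun b c ⟨d, hd⟩ => ?_⟩, huI, hua⟩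
  obtain ⟨w, x, y, z, rfl, rfl, rfl, -⟩ := href b c u d hd
  by_cases hw : w ∈ I
  · have hy : y ∉ I := fun hy => huI (hI.2.1 w y hw hy)
    exact Or.inr ((hmin' y hy (algLE_add_left y w)).trans (algLE_add_right y z))
  · exact Or.inl ((hmin' w hw (algLE_add_right w y)).trans (algLE_add_right w x))

theorem exists_inLowerCover_of_classLT [AddMonoid.FG M] {p q : M} (hq : IsPrimeElem q)
    (hqp : classLT q p) : ∃ t, InLowerCover p t ∧ algLE q t := by
  classical
  obtain ⟨S, hS⟩ := AddMonoid.FG.fg_top (M := M)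
  have hlt {t t' : M} (ht' : IsPrimeElem t') (h : classLT t t') :
      (S.filter (algLE · t)).card < (S.filter (algLE · t')).card := by
    obtain ⟨g, hg, h1, h2⟩ := ht'.exists_mem_algLE_of_closure (S := S) (x := t')
      (by simp [hS]) (algLE.refl t')
    refine Finset.card_lt_card ((Finset.ssubset_iff_of_subset fun x hx => ?_).2 ⟨g, ?_, ?_⟩)
    · simp only [Finset.mem_filter] at hx ⊢
      exact ⟨hx.1, hx.2.trans h.1⟩
    · simpa using ⟨hg, h2⟩
    · simp only [Finset.mem_filter, not_and]
      exact fun _ h3 => h.2 (h1.trans h3)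
  have hwf : WellFounded fun t t' : M =>
      S.card - (S.filter (algLE · t)).card < S.card - (S.filter (algLE · t')).card :=
    (measure fun t : M => S.card - (S.filter (algLE · t)).card).wf
  obtain ⟨t, ⟨ht, hqt, htp⟩, hmax⟩ := hwf.has_min
    {t | IsPrimeElem t ∧ algLE q t ∧ classLT t p} ⟨q, hq, algLE.refl q, hqp⟩
  refine ⟨t, ⟨ht, htp, fun ⟨t', ht', htt', ht'p⟩ => ?_⟩, hqt⟩
  refine hmax t' ⟨ht', hqt.trans htt'.1, ht'p⟩ ?_
  have h1 := hlt ht' htt'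
  have h2 := Finset.card_filter_le S (algLE · t')
  omega

/-- Everything strictly below a prime lies in the order-ideal generated by its lower cover. -/
theorem IsLowerCoverReps.exists_algLE_nsmul [AddMonoid.FG M] (href : IsRefinement M) {p : M}
    {Q : Finset M} (hQ : IsLowerCoverReps p Q) {a : M} (hap : algLE a p) (hpa : ¬ algLE p a) :
    ∃ n : ℕ, 0 < n ∧ algLE a (n • ∑ q ∈ Q, q) := by
  classical
  have hI : IsOrderIdeal {x : M | ∃ n : ℕ, 0 < n ∧ algLE x (n • ∑ q ∈ Q, q)} := by
    refine ⟨⟨1, one_pos, zero_algLE _⟩, ?_, ?_⟩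
    · rintro x y ⟨n, hn, hx⟩ ⟨m, -, hy⟩
      exact ⟨n + m, by omega, by rw [add_nsmul]; exact hx.add hy⟩
    · rintro x y hxy ⟨n, hn, hy⟩
      exact ⟨n, hn, hxy.trans hy⟩
  by_contra ha
  obtain ⟨u, hu, huI, hua⟩ := exists_isPrimeElem_notMem_of_notMem href hI ha
  obtain ⟨t, ht, hut⟩ := exists_inLowerCover_of_classLT hu
    ⟨hua.trans hap, fun h => hpa (h.trans hua)⟩
  obtain ⟨q, hq, -, htq⟩ := hQ.2.2 t ht
  refine huI ⟨1, one_pos, hut.trans (htq.trans ?_)⟩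
  rw [one_nsmul, ← Finset.add_sum_erase Q (fun q => q) hq]
  exact algLE_add_right _ _

end Order

section Expansion

open Relation

/-- One expansion step in the free commutative monoid on `V`: a vertex `v` is replaced by
`out v`. -/
def ExpandStep {V : Type} (out : V → V →₀ ℕ) (x y : V →₀ ℕ) : Prop :=
  ∃ (v : V) (d : V →₀ ℕ), x = Finsupp.single v 1 + d ∧ y = out v + d

theorem ExpandStep.add_right {V : Type} {out : V → V →₀ ℕ} {x y : V →₀ ℕ} (z : V →₀ ℕ) :
    ExpandStep out x y → ExpandStep out (x + z) (y + z) := by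
  rintro ⟨v, d, rfl, rfl⟩
  exact ⟨v, d + z, add_assoc _ _ _, add_assoc _ _ _⟩

theorem ExpandStep.diamond {V : Type} {out : V → V →₀ ℕ} (x y z : V →₀ ℕ) :
    ExpandStep out x y → ExpandStep out x z →
      ∃ w, ReflGen (ExpandStep out) y w ∧ ReflTransGen (ExpandStep out) z w := by
  classical
  rintro ⟨v, d, rfl, rfl⟩ ⟨u, d', h, rfl⟩
  rcases eq_or_ne v u with rfl | hvu
  · obtain rfl := add_left_cancel h
    exact ⟨_, ReflGen.refl, ReflTransGen.refl⟩
  · have hu : Finsupp.single u 1 ≤ d := by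
      rw [Finsupp.single_le_iff]
      have := DFunLike.congr_fun h u
      simp [hvu] at this
      omega
    obtain ⟨t, rfl⟩ := exists_add_of_le hu
    have hd' : d' = Finsupp.single v 1 + t := by
      apply add_left_cancel (a := Finsupp.single u 1)
      rw [← h]
      abel
    subst hd'
    exact ⟨out v + out u + t, ReflGen.single ⟨u, out v + t, by abel, by abel⟩,
      ReflTransGen.single ⟨v, out u + t, by abel, by abel⟩⟩

/-- The congruence of having a common expansion. -/
def joinExpandCon {V : Type} (out : V → V →₀ ℕ) : AddCon (V →₀ ℕ) where
  r := Join (ReflTransGen (ExpandStep out))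
  iseqv := equivalence_join_reflTransGen ExpandStep.diamond
  add' := by
    have hadd {x y z w : V →₀ ℕ} (h : ReflTransGen (ExpandStep out) x y)
        (h' : ReflTransGen (ExpandStep out) z w) :
        ReflTransGen (ExpandStep out) (x + z) (y + w) := by
      have h1 : ReflTransGen (ExpandStep out) (x + z) (y + z) :=
        h.lift (· + z) fun _ _ => ExpandStep.add_right z
      have h2 : ReflTransGen (ExpandStep out) (z + y) (w + y) :=
        h'.lift (· + y) fun _ _ => ExpandStep.add_right y
      rw [add_comm z y, add_comm w y] at h2
      exact h1.trans h2
    rintro x y z w ⟨t, h1, h2⟩ ⟨t', h1', h2'⟩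
    exact ⟨t + t', hadd h1 h1', hadd h2 h2'⟩

open Classical in
/-- The right-hand side of the relation at `v`, with sinks expanding to themselves. -/
noncomputable def expand (G : RowFiniteGraph) (v : G.V) : G.V →₀ ℕ :=
  if ∃ e : G.E, G.s e = v then
    ∑ e ∈ (G.rowFinite v).toFinset, Finsupp.single (G.r e) 1
  else Finsupp.single v 1

theorem join_expandStep_of_addConGen {G : RowFiniteGraph} {x y : G.V →₀ ℕ}
    (h : addConGen (graphRel G) x y) : Join (ReflTransGen (ExpandStep (expand G))) x y := by
  have hle : addConGen (graphRel G) ≤ joinExpandCon (expand G) := by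
    rw [AddCon.addConGen_le]
    rintro x y ⟨v, hv, rfl, rfl⟩
    refine ⟨_, ReflTransGen.single ⟨v, 0, (add_zero _).symm, ?_⟩, ReflTransGen.refl⟩
    rw [expand, if_pos hv, add_zero]
  exact hle h

theorem addConGen_expand (G : RowFiniteGraph) (v : G.V) :
    addConGen (graphRel G) (Finsupp.single v 1) (expand G v) := by
  by_cases hv : ∃ e : G.E, G.s e = v
  · exact AddConGen.Rel.of _ _ ⟨v, hv, rfl, by rw [expand, if_pos hv]⟩
  · rw [expand, if_neg hv]
    exact (addConGen (graphRel G)).refl _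

/-- A graph monoid is presented by a confluent family of expansions. -/
theorem IsGraphMonoid.exists_confluent_presentation {M : Type} [AddCommMonoid M]
    (h : IsGraphMonoid M) : ∃ (V : Type) (out : V → V →₀ ℕ) (F : (V →₀ ℕ) →+ M),
      Function.Surjective F ∧ (∀ v, F (Finsupp.single v 1) = F (out v)) ∧
      ∀ x y, F x = F y → Join (ReflTransGen (ExpandStep out)) x y := by
  obtain ⟨G, ⟨f⟩⟩ := h
  let mk : (G.V →₀ ℕ) →+ graphMonoid G := (addConGen (graphRel G)).mk'
  have hmk {x y : G.V →₀ ℕ} : mk x = mk y ↔ addConGen (graphRel G) x y := AddCon.eq _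
  refine ⟨G.V, expand G, f.symm.toAddMonoidHom.comp mk,
    f.symm.surjective.comp AddCon.mk'_surjective, fun v => ?_, fun x y hxy => ?_⟩
  · exact congrArg f.symm (hmk.2 (addConGen_expand G v))
  · exact join_expandStep_of_addConGen (hmk.1 (f.symm.injective hxy))

variable {M : Type} [AddCommMonoid M]

theorem IsPrimeElem.exists_single_algLE {p : M} (hp : IsPrimeElem p) {V : Type}
    (F : (V →₀ ℕ) →+ M) (x : V →₀ ℕ) (h : algLE p (F x)) :
    ∃ (v : V) (d : V →₀ ℕ), x = Finsupp.single v 1 + d ∧ algLE p (F (Finsupp.single v 1)) := by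
  induction x using Finsupp.induction_linear with
  | zero => exact absurd (by simpa using h) hp.not_algLE_zero
  | add x y ihx ihy =>
    rw [map_add] at h
    rcases hp.2 _ _ h with h | h
    · obtain ⟨v, d, rfl, hv⟩ := ihx h
      exact ⟨v, d + y, add_assoc _ _ _, hv⟩
    · obtain ⟨v, d, rfl, hv⟩ := ihy h
      exact ⟨v, x + d, by abel, hv⟩
  | single v n =>
    induction n with
    | zero => exact absurd (by simpa using h) hp.not_algLE_zero
    | succ n ih =>
      rw [Finsupp.single_add, map_add] at h
      rcases hp.2 _ _ h with h | h
      · obtain ⟨u, d, hd, hu⟩ := ih h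
        exact ⟨u, d + Finsupp.single v 1, by rw [Finsupp.single_add, hd, add_assoc], hu⟩
      · exact ⟨v, Finsupp.single v n, by rw [Finsupp.single_add, add_comm], h⟩

/-- In a graph monoid the vertices equivalent to a free prime `p` carry a self-map `next`, each one
expanding to its successor plus an element `δ` not above `p`, and equalities between elements
containing `p` once come from following the orbits of `next`. -/
theorem IsGraphMonoid.exists_orbit_description (h : IsGraphMonoid M) {p : M} (hp : IsPrimeElem p)
    (hfree : IsFreeElem p) :
    ∃ (P : Type) (next : P → P) (val δ : P → M), Nonempty P ∧
      (∀ v, algLE p (val v) ∧ algLE (val v) p) ∧ (∀ v, val v = val (next v) + δ v) ∧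
      ∀ (v : P) (a b : M), ¬ algLE p a → ¬ algLE p b → val v + a = val v + b →
        ∃ k l : ℕ, next^[k] v = next^[l] v ∧
          a + birkhoffSum next δ k v = b + birkhoffSum next δ l v := by
  classical
  obtain ⟨V, out, F, hF, hout, hconf⟩ := h.exists_confluent_presentation
  let P : Type := {v : V // algLE p (F (Finsupp.single v 1)) ∧ algLE (F (Finsupp.single v 1)) p}
  have hnext (v : P) : ∃ (w : P) (e : V →₀ ℕ),
      out v.1 = Finsupp.single w.1 1 + e ∧ ¬ algLE p (F e) := by
    have hpv : algLE p (F (out v.1)) := hout v.1 ▸ v.2.1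
    obtain ⟨w, e, hwe, hw⟩ := hp.exists_single_algLE F _ hpv
    have hle : algLE (F (Finsupp.single w 1) + F e) p := by
      rw [← map_add, ← hwe, ← hout]
      exact v.2.2
    refine ⟨⟨w, hw, (algLE_add_right _ _).trans hle⟩, e, hwe, fun he => ?_⟩
    exact algLE.not_of_isFreeElem hfree ((hw.add he).trans hle)
  choose next ex hnext hex using hnext
  have hreach (v : P) (c : V →₀ ℕ) (hc : ¬ algLE p (F c)) (z : V →₀ ℕ)
      (hz : ReflTransGen (ExpandStep out) (Finsupp.single v.1 1 + c) z) :
      ∃ (k : ℕ) (c' : V →₀ ℕ), z = Finsupp.single (next^[k] v).1 1 + c' ∧ ¬ algLE p (F c') ∧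
        F c' = F c + ∑ i ∈ Finset.range k, F (ex (next^[i] v)) := by
    induction hz with
    | refl => exact ⟨0, c, rfl, hc, by simp⟩
    | tail _ hstep ih =>
      obtain ⟨k, c', rfl, hc', hFc'⟩ := ih
      obtain ⟨w, d, hwd, rfl⟩ := hstep
      by_cases hw : (next^[k] v).1 = w
      · subst hw
        obtain rfl := add_left_cancel hwd
        refine ⟨k + 1, ex (next^[k] v) + c', ?_, ?_, ?_⟩
        · rw [hnext, Function.iterate_succ_apply', add_assoc]
        · rw [map_add]
          exact hp.not_algLE_add (hex _) hc'
        · rw [map_add, hFc', Finset.sum_range_succ]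
          abel
      · have hwc : Finsupp.single w 1 ≤ c' := by
          rw [Finsupp.single_le_iff]
          have := DFunLike.congr_fun hwd w
          simp [hw] at this
          omega
        obtain ⟨t, rfl⟩ := exists_add_of_le hwc
        have hd : d = Finsupp.single (next^[k] v).1 1 + t := by
          apply add_left_cancel (a := Finsupp.single w 1)
          rw [← hwd]
          abel
        have hFt : F (out w + t) = F (Finsupp.single w 1 + t) := by
          rw [map_add, map_add, hout]
        exact ⟨k, out w + t, by rw [hd]; abel, by rwa [hFt], by rw [hFt, hFc']⟩
  refine ⟨P, next, fun v => F (Finsupp.single v.1 1), fun v => F (ex v), ?_, fun v => v.2,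
    fun v => by rw [← map_add, ← hnext, ← hout], fun v a b ha hb hab => ?_⟩
  · obtain ⟨x, hx⟩ := hF p
    obtain ⟨v, d, rfl, hv⟩ := hp.exists_single_algLE F x (hx ▸ algLE.refl p)
    exact ⟨⟨v, hv, F d, by rw [← map_add, hx]⟩⟩
  · obtain ⟨x, rfl⟩ := hF a
    obtain ⟨y, rfl⟩ := hF b
    obtain ⟨z, hxz, hyz⟩ := hconf (Finsupp.single v.1 1 + x) (Finsupp.single v.1 1 + y)
      (by simpa only [map_add] using hab)
    obtain ⟨k, c, rfl, -, hFc⟩ := hreach v x ha z hxz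
    obtain ⟨l, d, hd, hpd, hFd⟩ := hreach v y hb _ hyz
    have hkl : (next^[k] v).1 = (next^[l] v).1 := by
      by_contra hne
      have hle : Finsupp.single (next^[k] v).1 1 ≤ d := by
        rw [Finsupp.single_le_iff]
        have := DFunLike.congr_fun hd (next^[k] v).1
        simp [Ne.symm hne] at this
        omega
      obtain ⟨t, rfl⟩ := exists_add_of_le hle
      rw [map_add] at hpd
      exact hpd ((next^[k] v).2.1.trans (algLE_add_right _ _))
    rw [hkl] at hd
    obtain rfl := add_left_cancel hd
    exact ⟨k, l, Subtype.ext hkl, hFc.symm.trans hFd⟩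

end Expansion

theorem birkhoffSum_mul_add_of_isPeriodicPt {P N : Type} [AddCommMonoid N] {f : P → P} (g : P → N)
    {n : ℕ} {v : P} (hv : Function.IsPeriodicPt f n v) (q r : ℕ) :
    birkhoffSum f g (n * q + r) v = q • birkhoffSum f g n v + birkhoffSum f g r v := by
  induction q with
  | zero => simp
  | succ q ih =>
    rw [Nat.mul_succ, add_comm (n * q) n, add_assoc, birkhoffSum_add, hv.eq, ih, add_nsmul,
      one_nsmul]
    abel

theorem mod_minimalPeriod_eq_of_iterate_eq {P : Type} {f : P → P} {v : P}
    (hv : v ∈ Function.periodicPts f) {k l : ℕ} (h : f^[k] v = f^[l] v) :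
    k % Function.minimalPeriod f v = l % Function.minimalPeriod f v := by
  have hpos := Function.minimalPeriod_pos_of_mem_periodicPts hv
  rw [← Function.iterate_eq_iterate_iff_of_lt_minimalPeriod (Nat.mod_lt k hpos)
    (Nat.mod_lt l hpos), Function.iterate_mod_minimalPeriod_eq,
    Function.iterate_mod_minimalPeriod_eq, h]

theorem eq_of_iterate_eq_of_forall_notMem_periodicPts {P : Type} {f : P → P}
    (hf : ∀ v, v ∉ Function.periodicPts f) {v : P} {k l : ℕ} (h : f^[k] v = f^[l] v) :
    k = l := by
  wlog hkl : k ≤ l generalizing k l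
  · exact (this h.symm (by omega)).symm
  by_contra hne
  refine hf (f^[k] v) ⟨l - k, by omega, ?_⟩
  rw [Function.IsPeriodicPt, Function.IsFixedPt, ← Function.iterate_add_apply,
    Nat.sub_add_cancel hkl, h]

theorem IsGrothendieck.exists_eq_sub {S : Type} [AddSemigroup S] {Γ : Type} [AddCommGroup Γ]
    {ι : AddHom S Γ} (hι : IsGrothendieck S Γ ι) (s : S) (γ : Γ) : ∃ a b : S, γ = ι a - ι b := by
  let H : AddSubgroup Γ :=
    { carrier := {γ | ∃ a b : S, γ = ι a - ι b}
      zero_mem' := ⟨s, s, (sub_self _).symm⟩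
      add_mem' := by
        rintro _ _ ⟨a, b, rfl⟩ ⟨c, d, rfl⟩
        exact ⟨a + c, b + d, by rw [map_add, map_add]; abel⟩
      neg_mem' := by
        rintro _ ⟨a, b, rfl⟩
        exact ⟨b, a, neg_sub _ _⟩ }
  have hmem (a : S) : ι a ∈ H := ⟨a + s, s, by rw [map_add, add_sub_cancel_right]⟩
  have huniq : QuotientAddGroup.mk' H = 0 :=
    (hι (Γ ⧸ H) ⟨fun _ => 0, fun _ _ => (add_zero 0).symm⟩).unique
      (fun a => (QuotientAddGroup.eq_zero_iff _).2 (hmem a)) (fun _ => rfl)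
  have hγ : γ ∈ H := (QuotientAddGroup.eq_zero_iff γ).1 (DFunLike.congr_fun huniq γ)
  exact hγ

/-- The elements absorbed by `p` up to equivalence. -/
def absorbed {M : Type} [AddCommMonoid M] (p : M) : AddSubmonoid M where
  carrier := {c | algLE (p + c) p}
  zero_mem' := ⟨0, by simp⟩
  add_mem' := by
    intro a b ha hb
    have h : algLE (p + a + b) (p + b) := algLE.add ha (algLE.refl b)
    rw [add_assoc] at h
    exact algLE.trans h hb

theorem not_algLE_of_mem_absorbed {M : Type} [AddCommMonoid M] {p c : M} (hfree : IsFreeElem p)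
    (hc : c ∈ absorbed p) : ¬ algLE p c :=
  fun h => algLE.not_of_isFreeElem hfree (((algLE.refl p).add h).trans hc)

theorem algLE_of_mem_absorbed {M : Type} [AddCommMonoid M] {p c : M} (hc : c ∈ absorbed p) :
    algLE c p :=
  (algLE_add_left c p).trans hc

theorem self_mem_archComp {M : Type} [AddCommMonoid M] (s : M) : s ∈ archComp s :=
  ⟨1, 1, one_pos, one_pos, by simpa using algLE.refl s, by simpa using algLE.refl s⟩

/-- The translate of a homomorphism on an archimedean component to a larger monoid of elements
which are carried into the component by adding a fixed element. -/
def translateHom {M : Type} [AddCommMonoid M] {S : AddSubsemigroup M} {Γ : Type} [AddCommGroup Γ]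
    (ι : AddHom S Γ) (N : AddSubmonoid M) (s : S) (hN : ∀ c ∈ N, c + (s : M) ∈ S) : N →+ Γ where
  toFun c := ι ⟨c + (s : M), hN c c.2⟩ - ι s
  map_zero' := by simp
  map_add' c d := by
    have h : ι ⟨(c + d : N) + (s : M), hN _ (c + d).2⟩ + ι s =
        ι ⟨c + (s : M), hN c c.2⟩ + ι ⟨d + (s : M), hN d d.2⟩ := by
      rw [← map_add, ← map_add]
      congr 1
      ext
      change (c : M) + d + s + s = c + s + (d + s)
      abel
    rw [sub_add_sub_comm, ← h]
    abel

theorem translateHom_apply_of_mem {M : Type} [AddCommMonoid M] {S : AddSubsemigroup M} {Γ : Type}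
    [AddCommGroup Γ] (ι : AddHom S Γ) (N : AddSubmonoid M) (s : S)
    (hN : ∀ c ∈ N, c + (s : M) ∈ S) (c : S) (hc : (c : M) ∈ N) :
    translateHom ι N s hN ⟨c, hc⟩ = ι c := by
  have h : ι ⟨(c : M) + s, hN c hc⟩ = ι c + ι s := by
    rw [← map_add]
    rfl
  simp [translateHom, h]

/-- Let `p` be a free prime of a graph monoid and let `u` be an element with `p + u = p`. Then there
is an `x` with `p + x = p` and `u` below a multiple of `x`, such that
elements with the same translate of `p` differ by a multiple of `x` in every abelian group. -/
theorem IsGraphMonoid.exists_generator {M : Type} [AddCommMonoid M] (h : IsGraphMonoid M) {p : M}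
    (hp : IsPrimeElem p) (hfree : IsFreeElem p) (u : absorbed p) (hu : p + (u : M) = p) :
    ∃ x : absorbed p, p + (x : M) = p ∧ (∃ m : ℕ, 0 < m ∧ algLE (u : M) (m • (x : M))) ∧
      ∀ (Γ : Type) [AddCommGroup Γ] (L : absorbed p →+ Γ) (a b : absorbed p),
        p + (a : M) = p + (b : M) → L a - L b ∈ AddSubgroup.zmultiples (L x) := by
  obtain ⟨P, next, val, δ, hP, hval, hδ, horb⟩ := h.exists_orbit_description hp hfree
  have hδN (v : P) : δ v ∈ absorbed p := by
    have h1 := (hval (next v)).1.add (algLE.refl (δ v))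
    rw [← hδ] at h1
    exact h1.trans (hval v).2
  let Δ (v : P) : absorbed p := ⟨δ v, hδN v⟩
  have hcoe (k : ℕ) (v : P) :
      ((birkhoffSum next Δ k v : absorbed p) : M) = birkhoffSum next δ k v := by
    simp [birkhoffSum, Δ]
  have horb' (v : P) (a b : absorbed p) (hab : p + (a : M) = p + (b : M)) :
      ∃ k l : ℕ, next^[k] v = next^[l] v ∧
        a + birkhoffSum next Δ k v = b + birkhoffSum next Δ l v := by
    obtain ⟨β, hβ⟩ := (hval v).1
    have hv : val v + (a : M) = val v + (b : M) := by
      rw [hβ, add_right_comm, hab, add_right_comm]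
    obtain ⟨k, l, hkl, hs⟩ := horb v a b (not_algLE_of_mem_absorbed hfree a.2)
      (not_algLE_of_mem_absorbed hfree b.2) hv
    exact ⟨k, l, hkl, Subtype.ext (by simpa [hcoe] using hs)⟩
  by_cases hper : ∃ v, v ∈ Function.periodicPts next
  · obtain ⟨v, hv⟩ := hper
    set n := Function.minimalPeriod next v with hn
    have hper : Function.IsPeriodicPt next n v := Function.isPeriodicPt_minimalPeriod next v
    have hpos : 0 < n := Function.minimalPeriod_pos_of_mem_periodicPts hv
    have hiter (k : ℕ) : val v = val (next^[k] v) + birkhoffSum next δ k v := by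
      induction k with
      | zero => simp
      | succ k ih =>
        rw [birkhoffSum_succ, Function.iterate_succ_apply', ← add_assoc, add_right_comm, ← hδ]
        exact ih
    refine ⟨birkhoffSum next Δ n v, ?_, ?_, fun Γ _ L a b hab => ?_⟩
    · obtain ⟨β, hβ⟩ := (hval v).2
      have h1 := hiter n
      rw [hper.eq] at h1
      rw [hcoe, hβ, add_right_comm, ← h1]
    · obtain ⟨k, l, -, hkl⟩ := horb' v u 0 (by simpa using hu)
      rw [zero_add] at hkl
      refine ⟨l + 1, l.succ_pos, ?_⟩
      have h1 := birkhoffSum_mul_add_of_isPeriodicPt Δ hper (l + 1) 0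
      have hle : n * (l + 1) + 0 = l + (n * (l + 1) - l) := by
        have := Nat.le_mul_of_pos_left (l + 1) hpos
        omega
      rw [hle, birkhoffSum_add, ← hkl, birkhoffSum_zero, add_zero] at h1
      have h2 := congrArg (Subtype.val) h1
      rw [AddSubmonoidClass.coe_nsmul] at h2
      rw [← h2]
      simp only [AddSubmonoid.coe_add, add_assoc]
      exact algLE_add_right _ _
    · obtain ⟨k, l, hkl, hab'⟩ := horb' v a b hab
      have hmod := mod_minimalPeriod_eq_of_iterate_eq hv hkl
      rw [← hn] at hmod
      have hL := congrArg L hab'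
      rw [← Nat.div_add_mod k n, ← Nat.div_add_mod l n,
        birkhoffSum_mul_add_of_isPeriodicPt Δ hper, birkhoffSum_mul_add_of_isPeriodicPt Δ hper,
        hmod] at hL
      simp only [map_add, map_nsmul] at hL
      refine AddSubgroup.mem_zmultiples_iff.2 ⟨(l / n : ℕ) - (k / n : ℕ), ?_⟩
      rw [sub_zsmul, natCast_zsmul, natCast_zsmul]
      rw [← add_assoc, ← add_assoc, add_left_inj] at hL
      rw [← sub_eq_add_neg, sub_eq_sub_iff_add_eq_add, add_comm, hL, add_comm]
  · have hinj (v : P) (a b : absorbed p) (hab : p + (a : M) = p + (b : M)) :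
        ∃ c, a + c = b + c := by
      obtain ⟨k, l, hkl, h⟩ := horb' v a b hab
      obtain rfl := eq_of_iterate_eq_of_forall_notMem_periodicPts (not_exists.1 hper) hkl
      exact ⟨_, h⟩
    refine ⟨u, hu, ⟨1, one_pos, by simpa using algLE.refl _⟩, fun Γ _ L a b hab => ?_⟩
    obtain ⟨c, hc⟩ := hinj hP.some a b hab
    have hL := congrArg L hc
    rw [map_add, map_add, add_left_inj] at hL
    rw [hL, sub_self]
    exact zero_mem _

/-- **necessity.** If a finitely generated conical refinement monoid `M`
is a graph monoid, then for every free prime `p` of `M` which is not minimal in the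
poset of primes, and every set `Q` of representatives of the lower cover of `p̄`, the
unique group homomorphism `G(φ_p) : G(M_{J_p}) → G'_p` induced by `φ_p` on a
Grothendieck group of `M_{J_p}` is surjective and its kernel is the cyclic subgroup
generated by `ι x` for some `x ∈ M_{J_p}`. -/
theorem almostIso_of_isGraphMonoid (M : Type) [AddCommMonoid M] [AddMonoid.FG M]
    (hcon : IsConical M) (href : IsRefinement M)
    (hgraph : IsGraphMonoid M)
    (p : M) (hprime : IsPrimeElem p) (hfree : IsFreeElem p)
    (hnonmin : ∃ q : M, IsPrimeElem q ∧ classLT q p)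
    (Q : Finset M) (hQ : IsLowerCoverReps p Q) :
    AlmostIsoCondition M p Q := by
  unfold AlmostIsoCondition
  have hcover {a : M} := hQ.exists_algLE_nsmul href (a := a)
  generalize ∑ q ∈ Q, q = s at hcover ⊢
  intro Γ _ ι hι G' _ j hj φ hφ ψ hψ
  have habs (a : archComp s) : (a : M) ∈ absorbed p := by
    have h : j (φ a) ∈ GpSet p := hj.range_eq ▸ Set.mem_range_self _
    obtain ⟨α, -, h⟩ := h
    rw [hφ] at h
    exact h
  have hφeq {a b : archComp s} : φ a = φ b ↔ p + (a : M) = p + (b : M) := by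
    rw [← hφ, ← hφ, hj.inj.eq_iff]
  have hmem {c : M} (hc : c ∈ absorbed p) (m : ℕ) (hm : 0 < m) (hsc : algLE s (m • c)) :
      c ∈ archComp s := by
    obtain ⟨n, hn, hcn⟩ := hcover (algLE_of_mem_absorbed hc)
      (not_algLE_of_mem_absorbed hfree hc)
    exact ⟨n, m, hn, hm, hcn, hsc⟩
  let s' : archComp s := ⟨s, self_mem_archComp s⟩
  obtain ⟨t, ht⟩ := habs s'
  have hu : p + (s + t) = p := by rw [← add_assoc, ← ht]
  have huN : s + t ∈ absorbed p := ⟨0, by rw [hu, add_zero]⟩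
  have hadd (c : M) (hc : c ∈ absorbed p) : c + s ∈ archComp s :=
    hmem (add_mem hc (habs s')) 1 one_pos (by simpa using algLE_add_left s c)
  let L := translateHom ι (absorbed p) s' hadd
  have hL (a : archComp s) : L ⟨a, habs a⟩ = ι a :=
    translateHom_apply_of_mem ι (absorbed p) s' hadd a (habs a)
  obtain ⟨x, hx, ⟨m, hm, hux⟩, hgen⟩ := hgraph.exists_generator hprime hfree ⟨s + t, huN⟩ hu
  have hxs : (x : M) ∈ archComp s := hmem x.2 m hm ((algLE_add_right s t).trans hux)
  refine ⟨fun g => ?_, ⟨x, hxs⟩, le_antisymm (fun γ hγ => ?_) ?_⟩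
  · obtain ⟨α, hα, hαp⟩ : j g ∈ GpSet p := hj.range_eq ▸ Set.mem_range_self g
    have hαu : p + (α + (s + t)) = p + α := by rw [add_left_comm, hu, add_comm]
    have hαN : α + (s + t) ∈ absorbed p := by
      change algLE _ p
      rw [hαu, ← hα]
      exact hαp
    have hαs : α + (s + t) ∈ archComp s :=
      hmem hαN 1 one_pos ⟨α + t, by rw [one_nsmul]; abel⟩
    refine ⟨ι ⟨_, hαs⟩, hj.inj ?_⟩
    rw [hψ, hφ, hα]
    exact hαu
  · obtain ⟨a, b, rfl⟩ := hι.exists_eq_sub s' γ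
    rw [AddMonoidHom.mem_ker, map_sub, hψ, hψ, sub_eq_zero, hφeq] at hγ
    have h := hgen Γ L ⟨a, habs a⟩ ⟨b, habs b⟩ hγ
    rwa [hL, hL, hL ⟨x, hxs⟩] at h
  · rw [AddSubgroup.zmultiples_le, AddMonoidHom.mem_ker, hψ]
    apply hj.inj
    rw [hφ, hj.map_zero]
    exact hx

end ArPardo
end

section
/- Let M be a finitely generated antisymmetric refinement monoid. Then M is a graph monoid if and only if for every free prime p of M, the lower cover of p in the poset of primes of M contains at most one free prime. -/
namespace ArPardo

section RefinementMonoid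

variable {M : Type} [AddCommMonoid M]

/-- The algebraic preorder of an antisymmetric monoid, as a partial order. -/
abbrev algPartialOrder (hanti : ∀ x y : M, algLE x y → algLE y x → x = y) : PartialOrder M where
  le := algLE
  le_refl x := ⟨0, (add_zero x).symm⟩
  le_trans := by
    rintro x y z ⟨u, rfl⟩ ⟨v, rfl⟩
    exact ⟨u + v, add_assoc x u v⟩
  le_antisymm := hanti

theorem canonicallyOrderedAdd_algPartialOrder
    (hanti : ∀ x y : M, algLE x y → algLE y x → x = y) :
    letI := algPartialOrder hanti
    CanonicallyOrderedAdd M :=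
  letI := algPartialOrder hanti
  { exists_add_of_le := fun h => h
    le_add_self := fun a b => ⟨b, add_comm b a⟩
    le_self_add := fun _ b => ⟨b, rfl⟩ }

variable [PartialOrder M] [CanonicallyOrderedAdd M]

theorem algLE_iff_le {x y : M} : algLE x y ↔ x ≤ y :=
  le_iff_exists_add.symm

theorem IsRefinement.exists_add_of_le (href : IsRefinement M) {x a b : M} (h : x ≤ a + b) :
    ∃ y z, x = y + z ∧ y ≤ a ∧ z ≤ b := by
  obtain ⟨c, hc⟩ := le_iff_exists_add.1 h
  obtain ⟨w, u, v, t, rfl, rfl, rfl, rfl⟩ := href a b x c hc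
  exact ⟨w, v, rfl, le_self_add, le_self_add⟩

theorem classLT_iff_lt {x y : M} : classLT x y ↔ x < y := by
  rw [classLT, algLE_iff_le, algLE_iff_le, lt_iff_le_not_ge]

theorem isPrimeElem_iff {p : M} :
    IsPrimeElem p ↔ p ≠ 0 ∧ ∀ a b : M, p ≤ a + b → p ≤ a ∨ p ≤ b := by
  simp only [IsPrimeElem, algLE_iff_le]
  refine and_congr_left fun _ => ⟨fun h h0 => h 0 (by simp [h0]), fun h q hq => h ?_⟩
  exact le_antisymm (hq ▸ le_self_add) (zero_le)

theorem IsPrimeElem.ne_zero {p : M} (hp : IsPrimeElem p) : p ≠ 0 :=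
  (isPrimeElem_iff.1 hp).1

theorem IsPrimeElem.le_or_le {p a b : M} (hp : IsPrimeElem p) (h : p ≤ a + b) : p ≤ a ∨ p ≤ b :=
  (isPrimeElem_iff.1 hp).2 a b h

theorem IsPrimeElem.not_le_zero {p : M} (hp : IsPrimeElem p) : ¬ p ≤ 0 := fun h =>
  hp.ne_zero (le_antisymm h zero_le)

theorem inLowerCover_iff {p q : M} :
    InLowerCover p q ↔ IsPrimeElem q ∧ q < p ∧ ∀ t, IsPrimeElem t → q < t → ¬ t < p := by
  simp only [InLowerCover, classLT_iff_lt, not_exists, not_and]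

theorem isFreeElem_iff {p : M} : IsFreeElem p ↔ ∀ n m : ℕ, n • p ≤ m • p → n ≤ m := by
  simp only [IsFreeElem, algLE_iff_le]

/-- A prime absorbs every element strictly below it. -/
theorem IsPrimeElem.add_eq_self_of_lt {p x : M} (hp : IsPrimeElem p) (h : x < p) : p + x = p := by
  obtain ⟨z, hz⟩ := le_iff_exists_add.1 h.le
  rcases hp.le_or_le hz.le with h' | h'
  · exact absurd h' h.not_ge
  · have : z = p := le_antisymm (hz ▸ le_add_self) h'
    rw [add_comm, ← this, ← hz, this]

theorem IsPrimeElem.le_of_le_sum {ι : Type} {p : M} (hp : IsPrimeElem p) {s : Finset ι}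
    {f : ι → M} (h : p ≤ ∑ i ∈ s, f i) : ∃ i ∈ s, p ≤ f i := by
  classical
  induction s using Finset.induction_on with
  | empty => exact absurd (by simpa using h) hp.not_le_zero
  | insert a s ha ih =>
    rw [Finset.sum_insert ha] at h
    rcases hp.le_or_le h with h | h
    · exact ⟨a, by simp, h⟩
    · obtain ⟨i, hi, hpi⟩ := ih h
      exact ⟨i, by simp [hi], hpi⟩

theorem IsPrimeElem.le_of_le_nsmul {p x : M} (hp : IsPrimeElem p) {n : ℕ} (h : p ≤ n • x) :
    n ≠ 0 ∧ p ≤ x := by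
  induction n with
  | zero => exact absurd (by simpa using h) hp.not_le_zero
  | succ n ih =>
    rw [succ_nsmul] at h
    exact ⟨n.succ_ne_zero, (hp.le_or_le h).elim (fun h => (ih h).2) id⟩

/-- In a well-founded antisymmetric refinement monoid every element is a sum of primes. -/
theorem closure_isPrimeElem_eq_top [WellFoundedLT M] (href : IsRefinement M) :
    AddSubmonoid.closure {p : M | IsPrimeElem p} = ⊤ := by
  refine eq_top_iff.2 fun x _ => ?_
  induction x using WellFoundedLT.induction with
  | ind x ih =>
    by_cases hx : IsPrimeElem x
    · exact AddSubmonoid.subset_closure hx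
    by_cases h0 : x = 0
    · exact h0 ▸ zero_mem _
    rw [isPrimeElem_iff] at hx
    push Not at hx
    obtain ⟨a, b, hab, ha, hb⟩ := hx h0
    obtain ⟨y, z, rfl, hy, hz⟩ := href.exists_add_of_le hab
    exact add_mem (ih y (lt_of_le_of_ne le_self_add fun h => ha (h ▸ hy)) trivial)
      (ih z (lt_of_le_of_ne le_add_self fun h => hb (h ▸ hz)) trivial)

theorem wellFoundedLT_of_fg [AddMonoid.FG M] : WellFoundedLT M := by
  obtain ⟨S, hS⟩ := (AddMonoid.FG.fg_top : (⊤ : AddSubmonoid M).FG)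
  let f : (S → ℕ) → M := fun c => ∑ s, c s • (s : M)
  have hf : Function.Surjective f := fun x => by
    have hx : x ∈ AddSubmonoid.closure (S : Set M) := hS ▸ trivial
    obtain ⟨c, hc⟩ := AddSubmonoid.mem_closure_finset'.1 hx
    exact ⟨c, hc.symm⟩
  have hmono : Monotone f := fun c d h =>
    Finset.sum_le_sum fun s _ => nsmul_le_nsmul_left zero_le (h s)
  have := hmono.wellQuasiOrderedLE_of_wellQuasiOrderedLE_of_surjective hf
  infer_instance

/-- Every generating set contains all primes. -/
theorem IsPrimeElem.mem_of_closure_eq_top {p : M} (hp : IsPrimeElem p) {S : Set M}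
    (hS : AddSubmonoid.closure S = ⊤) : p ∈ S := by
  have hpS : p ∈ AddSubmonoid.closure S := hS ▸ trivial
  obtain ⟨c, t, ht, -, hc⟩ := AddSubmonoid.mem_closure_iff_exists_finset_subset.1 hpS
  obtain ⟨s, hs, hps⟩ := hp.le_of_le_sum hc.ge
  obtain ⟨hc0, hps⟩ := hp.le_of_le_nsmul hps
  have hsp : s ≤ p := calc
    s = 1 • s := (one_nsmul s).symm
    _ ≤ c s • s := nsmul_le_nsmul_left zero_le (Nat.one_le_iff_ne_zero.2 hc0)
    _ ≤ ∑ a ∈ t, c a • a := Finset.single_le_sum (f := fun a => c a • a) (fun _ _ => zero_le) hs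
    _ = p := hc
  exact le_antisymm hps hsp ▸ ht hs

theorem finite_isPrimeElem [AddMonoid.FG M] : {p : M | IsPrimeElem p}.Finite := by
  obtain ⟨S, hS⟩ := (AddMonoid.FG.fg_top : (⊤ : AddSubmonoid M).FG)
  exact S.finite_toSet.subset fun p hp => hp.mem_of_closure_eq_top hS

/-- Cancellation of a non-idempotent prime `p` from elements above `p`. -/
theorem IsPrimeElem.cancel (href : IsRefinement M) {p x y : M} (hp : IsPrimeElem p)
    (h2 : ¬ p + p ≤ p) (hx : p ≤ x) (hy : p ≤ y) (h : p + x = p + y) : x = y := by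
  obtain ⟨w, s, u, t, h1, rfl, h3, rfl⟩ := href p x p y h
  rcases hp.le_or_le h1.le with hw | hs
  · have hw' : w = p := le_antisymm (h1 ▸ le_self_add) hw
    subst hw'
    have hu : ¬ w ≤ u := fun hu => h2 (by nth_rw 3 [h3]; exact add_le_add_right hu w)
    have hs : ¬ w ≤ s := fun hs => h2 (by nth_rw 3 [h1]; exact add_le_add_right hs w)
    have ht : w ≤ t := (hp.le_or_le hx).resolve_left hu
    obtain ⟨c, rfl⟩ := le_iff_exists_add.1 ht
    rw [← add_assoc, ← add_assoc, add_comm u, add_comm s, ← h3, ← h1]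
  · have hs' : s = p := le_antisymm (h1 ▸ le_add_self) hs
    have hw : ¬ p ≤ w := fun hw => h2 (by nth_rw 3 [h1]; exact add_le_add hw hs)
    have hu : p ≤ u := (hp.le_or_le h3.le).resolve_left hw
    have hu' : u = p := le_antisymm (h3 ▸ le_add_self) hu
    rw [hs', hu']

/-- A prime of an antisymmetric refinement monoid is either free or idempotent. -/
theorem IsPrimeElem.free_or_idem (href : IsRefinement M) {p : M} (hp : IsPrimeElem p) :
    IsFreeElem p ∨ p + p = p := by
  by_cases h2 : p + p ≤ p
  · exact Or.inr (le_antisymm h2 le_self_add)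
  have key : ∀ (m : ℕ) (z : M), (m + 1) • p + z ≠ m • p := by
    intro m
    induction m with
    | zero =>
      intro z h
      exact hp.not_le_zero (by simpa using (le_self_add.trans h.le : (0 + 1) • p ≤ 0 • p))
    | succ m ih =>
      intro z h
      rcases Nat.eq_zero_or_pos m with rfl | hm
      · apply h2
        rw [zero_add, one_nsmul, two_nsmul] at h
        exact le_self_add.trans h.le
      · have hpm : ∀ k : ℕ, 0 < k → p ≤ k • p := fun k hk => by
          simpa using nsmul_le_nsmul_left (zero_le : 0 ≤ p) hk
        refine ih z (hp.cancel href h2 ((hpm _ m.succ_pos).trans le_self_add) (hpm m hm) ?_)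
        rw [← add_assoc, ← succ_nsmul', ← succ_nsmul', h]
  refine Or.inl (isFreeElem_iff.2 fun n m hnm => ?_)
  by_contra hlt
  obtain ⟨k, rfl⟩ := Nat.exists_eq_add_of_lt (not_le.1 hlt)
  obtain ⟨z, hz⟩ := le_iff_exists_add.1 hnm
  refine key m (k • p + z) ?_
  rw [hz, add_right_comm m k 1, add_nsmul p (m + 1) k, add_assoc]

theorem IsFreeElem.add_self_ne {p : M} (hp : IsFreeElem p) : p + p ≠ p := fun h => by
  have := isFreeElem_iff.1 hp 2 1 (by rw [two_nsmul, one_nsmul, h])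
  omega

theorem IsPrimeElem.nsmul_eq_left (href : IsRefinement M) {p : M} (hp : IsPrimeElem p) :
    ∀ (n : ℕ) {u v : M}, n • p = u + v → ¬ p ≤ v → n • p ≤ u := by
  intro n
  induction n with
  | zero => intro u v _ _; simp
  | succ n ih =>
    intro u v h hv
    rw [succ_nsmul'] at h ⊢
    obtain ⟨w, x, y, z, h1, h2, rfl, rfl⟩ := href _ _ _ _ h
    have hw : p ≤ w := (hp.le_or_le h1.le).resolve_right fun hx => hv (hx.trans le_self_add)
    exact add_le_add hw (ih h2 fun hz => hv (hz.trans le_add_self))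

theorem IsPrimeElem.le_of_nsmul_le (href : IsRefinement M) {p : M} (hp : IsPrimeElem p)
    (hfree : IsFreeElem p) {n m : ℕ} {y : M} (h : n • p ≤ m • p + y) (hy : ¬ p ≤ y) : n ≤ m := by
  obtain ⟨u, v, huv, hu, hv⟩ := href.exists_add_of_le h
  exact isFreeElem_iff.1 hfree n m
    ((hp.nsmul_eq_left href n huv fun hpv => hy (hpv.trans hv)).trans hu)

end RefinementMonoid

section Count

variable {M : Type} [AddCommMonoid M] [PartialOrder M] [CanonicallyOrderedAdd M]

/-- `q` occurs exactly `n` times in `x`: `x = n • q + y` with `q ≰ y`. -/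
def HasCount (q x : M) (n : ℕ) : Prop :=
  ∃ y, x = n • q + y ∧ ¬ q ≤ y

theorem HasCount.le (href : IsRefinement M) {q x : M} (hq : IsPrimeElem q) (hfree : IsFreeElem q)
    {n m : ℕ} (hn : HasCount q x n) (hm : HasCount q x m) : n ≤ m := by
  obtain ⟨y, rfl, -⟩ := hn
  obtain ⟨z, hz, hqz⟩ := hm
  exact hq.le_of_nsmul_le href hfree (hz ▸ le_self_add) hqz

theorem HasCount.add {q x y : M} (hq : IsPrimeElem q) {n m : ℕ} (hn : HasCount q x n)
    (hm : HasCount q y m) : HasCount q (x + y) (n + m) := by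
  obtain ⟨u, rfl, hu⟩ := hn
  obtain ⟨v, rfl, hv⟩ := hm
  exact ⟨u + v, by rw [add_nsmul]; abel, fun h => (hq.le_or_le h).elim hu hv⟩

open Classical in
/-- The number of occurrences of `q` in `x` (zero if there is none well defined). -/
noncomputable def count (q x : M) : ℕ :=
  if h : ∃ n, HasCount q x n then h.choose else 0

theorem HasCount.count_eq (href : IsRefinement M) {q x : M} (hq : IsPrimeElem q)
    (hfree : IsFreeElem q) {n : ℕ} (hn : HasCount q x n) : count q x = n := by
  have h : ∃ n, HasCount q x n := ⟨n, hn⟩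
  rw [count, dif_pos h]
  exact le_antisymm (h.choose_spec.le href hq hfree hn) (hn.le href hq hfree h.choose_spec)

theorem count_add (href : IsRefinement M) {q x y : M} (hq : IsPrimeElem q) (hfree : IsFreeElem q)
    (hx : ∃ n, HasCount q x n) (hy : ∃ n, HasCount q y n) :
    count q (x + y) = count q x + count q y := by
  obtain ⟨n, hn⟩ := hx
  obtain ⟨m, hm⟩ := hy
  rw [(hn.add hq hm).count_eq href hq hfree, hn.count_eq href hq hfree, hm.count_eq href hq hfree]

theorem count_self (href : IsRefinement M) {q : M} (hq : IsPrimeElem q) (hfree : IsFreeElem q) :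
    count q q = 1 :=
  HasCount.count_eq href hq hfree ⟨0, by simp, hq.not_le_zero⟩

theorem count_eq_zero (href : IsRefinement M) {q x : M} (hq : IsPrimeElem q)
    (hfree : IsFreeElem q) (h : ¬ q ≤ x) : count q x = 0 :=
  HasCount.count_eq href hq hfree ⟨x, by simp, h⟩

theorem add_eq_self_left_of_add {p x y : M} (h : p + (x + y) = p) : p + x = p :=
  le_antisymm (calc
    p + x ≤ p + x + y := le_self_add
    _ = p := by rw [add_assoc, h]) le_self_add

theorem add_eq_self_right_of_add {p x y : M} (h : p + (x + y) = p) : p + y = p :=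
  add_eq_self_left_of_add (y := x) (by rwa [add_comm y])

/-- A prime in the lower cover of a free prime `p` has a multiplicity in every element
absorbed by `p`. -/
theorem exists_hasCount (hgen : AddSubmonoid.closure {p : M | IsPrimeElem p} = ⊤) {p q : M}
    (hfree : IsFreeElem p) (hpq : InLowerCover p q) (x : M) :
    p + x = p → ∃ n, HasCount q x n := by
  rw [inLowerCover_iff] at hpq
  obtain ⟨hq, hqp, hmax⟩ := hpq
  have hx : x ∈ AddSubmonoid.closure {p : M | IsPrimeElem p} := hgen ▸ trivial
  induction hx using AddSubmonoid.closure_induction with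
  | mem r hr =>
    intro h
    have hrp : r < p := lt_of_le_of_ne (h ▸ le_add_self) fun hrp => hfree.add_self_ne (hrp ▸ h)
    by_cases hqr : q ≤ r
    · have : q = r := by
        by_contra hne
        exact hmax r hr (lt_of_le_of_ne hqr hne) hrp
      exact ⟨1, 0, by simp [this], hq.not_le_zero⟩
    · exact ⟨0, r, by simp, hqr⟩
  | zero => exact fun _ => ⟨0, 0, by simp, hq.not_le_zero⟩
  | add x y _ _ ihx ihy =>
    intro h
    obtain ⟨n, hn⟩ := ihx (add_eq_self_left_of_add h)
    obtain ⟨m, hm⟩ := ihy (add_eq_self_right_of_add h)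
    exact ⟨n + m, hn.add hq hm⟩

end Count

section Confluence

variable (G : RowFiniteGraph)

/-- The multiset of ranges of the edges emitted by `v`. -/
noncomputable def outSum (v : G.V) : G.V →₀ ℕ :=
  ∑ e ∈ (G.rowFinite v).toFinset, Finsupp.single (G.r e) 1

/-- One-step reduction: replace an occurrence of a non-sink `v` by the ranges of its edges. -/
def Reduces (x y : G.V →₀ ℕ) : Prop :=
  ∃ v z, (∃ e : G.E, G.s e = v) ∧ x = Finsupp.single v 1 + z ∧ y = outSum G v + z

variable {G}

theorem Reduces.add_right {x y : G.V →₀ ℕ} (h : Reduces G x y) (w : G.V →₀ ℕ) :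
    Reduces G (x + w) (y + w) := by
  obtain ⟨v, z, hv, rfl, rfl⟩ := h
  exact ⟨v, z + w, hv, add_assoc _ _ _, add_assoc _ _ _⟩

theorem single_add_eq_single_add {V : Type} {v w : V} {y z : V →₀ ℕ}
    (h : Finsupp.single v 1 + y = Finsupp.single w 1 + z) :
    (v = w ∧ y = z) ∨
      (v ≠ w ∧ ∃ t, y = Finsupp.single w 1 + t ∧ z = Finsupp.single v 1 + t) := by
  classical
  by_cases hvw : v = w
  · subst hvw
    exact Or.inl ⟨rfl, add_left_cancel h⟩
  · refine Or.inr ⟨hvw, ?_⟩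
    have hle : Finsupp.single w 1 ≤ y := by
      rw [Finsupp.single_le_iff]
      have := DFunLike.congr_fun h w
      simp only [Finsupp.add_apply, Finsupp.single_apply, if_neg hvw, if_true] at this
      omega
    obtain ⟨t, rfl⟩ := le_iff_exists_add.1 hle
    refine ⟨t, rfl, ?_⟩
    rw [add_left_comm] at h
    exact (add_left_cancel h).symm

theorem reduces_diamond (a b c : G.V →₀ ℕ) (hb : Reduces G a b) (hc : Reduces G a c) :
    ∃ d, Relation.ReflGen (Reduces G) b d ∧ Relation.ReflTransGen (Reduces G) c d := by
  obtain ⟨v, y, hv, rfl, rfl⟩ := hb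
  obtain ⟨w, z, hw, h, rfl⟩ := hc
  rcases single_add_eq_single_add h with ⟨rfl, rfl⟩ | ⟨-, t, rfl, rfl⟩
  · exact ⟨_, Relation.ReflGen.refl, Relation.ReflTransGen.refl⟩
  · refine ⟨outSum G v + (outSum G w + t), Relation.ReflGen.single ?_,
      Relation.ReflTransGen.single ?_⟩
    · exact ⟨w, outSum G v + t, hw, add_left_comm _ _ _, add_left_comm _ _ _⟩
    · exact ⟨v, outSum G w + t, hv, add_left_comm _ _ _, rfl⟩

theorem join_reduces_add {a b c d : G.V →₀ ℕ}
    (hab : Relation.Join (Relation.ReflTransGen (Reduces G)) a b)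
    (hcd : Relation.Join (Relation.ReflTransGen (Reduces G)) c d) :
    Relation.Join (Relation.ReflTransGen (Reduces G)) (a + c) (b + d) := by
  have key : ∀ {a b c d : G.V →₀ ℕ}, Relation.ReflTransGen (Reduces G) a b →
      Relation.ReflTransGen (Reduces G) c d →
      Relation.ReflTransGen (Reduces G) (a + c) (b + d) := by
    intro a b c d hab hcd
    refine (hab.lift (fun x => x + c) fun x y h => h.add_right c).trans ?_
    refine hcd.lift (fun x => b + x) fun x y h => ?_
    simpa only [add_comm b] using h.add_right b
  obtain ⟨x, hax, hbx⟩ := hab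
  obtain ⟨y, hcy, hdy⟩ := hcd
  exact ⟨x + y, key hax hcy, key hbx hdy⟩

/-- Elements of the free monoid with the same class in the graph monoid have a common reduct. -/
theorem join_reduces_of_mk_eq {x y : G.V →₀ ℕ}
    (h : (addConGen (graphRel G)).mk' x = (addConGen (graphRel G)).mk' y) :
    Relation.Join (Relation.ReflTransGen (Reduces G)) x y := by
  let c : AddCon (G.V →₀ ℕ) :=
    { r := Relation.Join (Relation.ReflTransGen (Reduces G))
      iseqv := Relation.equivalence_join_reflTransGen reduces_diamond
      add' := join_reduces_add }
  have hle : addConGen (graphRel G) ≤ c := by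
    refine AddCon.addConGen_le.2 ?_
    rintro _ _ ⟨v, hv, rfl, rfl⟩
    exact ⟨outSum G v, Relation.ReflTransGen.single ⟨v, 0, hv, by simp, by simp⟩,
      Relation.ReflTransGen.refl⟩
  exact hle ((AddCon.eq _).1 h)

theorem mk_single_eq_mk_outSum {v : G.V} (hv : ∃ e : G.E, G.s e = v) :
    (addConGen (graphRel G)).mk' (Finsupp.single v 1) =
      (addConGen (graphRel G)).mk' (outSum G v) :=
  (AddCon.eq _).2 (AddConGen.Rel.of _ _ ⟨v, hv, rfl, rfl⟩)

end Confluence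

/-- The partial sums of two nonnegative integral sequences along an orbit `v` cannot return with
both increments `(1, 0)` and `(0, 1)`. -/
theorem not_return_both {V : Type} (F : V → V) (d : V → ℕ × ℕ) (v : V) {i k i' k' : ℕ}
    (hv : F^[i] v = F^[k] v) (hv' : F^[i'] v = F^[k'] v)
    (h : ∑ j ∈ Finset.range i, d (F^[j] v) = (1, 0) + ∑ j ∈ Finset.range k, d (F^[j] v))
    (h' : ∑ j ∈ Finset.range i', d (F^[j] v) = (0, 1) + ∑ j ∈ Finset.range k', d (F^[j] v)) :
    False := by
  set D : ℕ → ℕ × ℕ := fun n => ∑ j ∈ Finset.range n, d (F^[j] v) with hD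
  have hsucc : ∀ n, D (n + 1) = D n + d (F^[n] v) := fun n => Finset.sum_range_succ _ n
  have hmono : Monotone D := monotone_nat_of_le_succ fun n => by
    rw [hsucc]; exact le_self_add
  have shift : ∀ {i k : ℕ} (e : ℕ × ℕ), F^[i] v = F^[k] v → D i = e + D k →
      ∀ n, D (i + n) = e + D (k + n) := by
    intro i k e hv h n
    induction n with
    | zero => exact h
    | succ n ih =>
      rw [← add_assoc, ← add_assoc, hsucc, hsucc, ih, add_comm i, add_comm k,
        Function.iterate_add_apply, Function.iterate_add_apply, hv, add_assoc]
  have hki : k < i := by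
    by_contra hle
    have h1 := (hmono (not_lt.1 hle)).1
    have h2 := congrArg Prod.fst h
    simp only [Prod.fst_add] at h2
    change (D i).1 = 1 + (D k).1 at h2
    omega
  have hconst : ∀ n, (D (k + n)).2 = (D k).2 := by
    intro n
    induction n with
    | zero => rfl
    | succ n ih =>
      have h1 := congrArg Prod.snd (shift _ hv h n)
      simp only [Prod.snd_add] at h1
      have h2 := (hmono (by omega : k + (n + 1) ≤ i + n)).2
      have h3 := (hmono (by omega : k + n ≤ k + (n + 1))).2
      omega
  have h1 := congrArg Prod.snd (shift _ hv' h' k)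
  simp only [Prod.snd_add] at h1
  rw [add_comm i', add_comm k', hconst, hconst] at h1
  omega

/-- The quotient map from the free commutative monoid on the vertices to the graph monoid. -/
noncomputable def toGraphMonoid (G : RowFiniteGraph) : (G.V →₀ ℕ) →+ graphMonoid G :=
  (addConGen (graphRel G)).mk'

theorem toGraphMonoid_surjective (G : RowFiniteGraph) : Function.Surjective (toGraphMonoid G) :=
  AddCon.mk'_surjective

theorem toGraphMonoid_single {G : RowFiniteGraph} {v : G.V} (hv : ∃ e : G.E, G.s e = v) :
    toGraphMonoid G (Finsupp.single v 1) = toGraphMonoid G (outSum G v) :=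
  mk_single_eq_mk_outSum hv

section Necessity

variable {M : Type} [AddCommMonoid M] [PartialOrder M] [CanonicallyOrderedAdd M]

theorem IsPrimeElem.exists_single_of_le {V : Type} {p : M} (hp : IsPrimeElem p)
    (θ : (V →₀ ℕ) →+ M) {x : V →₀ ℕ} (h : p ≤ θ x) :
    ∃ v z, x = Finsupp.single v 1 + z ∧ p ≤ θ (Finsupp.single v 1) := by
  have hx : θ x = ∑ v ∈ x.support, x v • θ (Finsupp.single v 1) := by
    conv_lhs => rw [← Finsupp.sum_single x]
    simp [Finsupp.sum, ← map_nsmul]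
  obtain ⟨v, -, hpv⟩ := hp.le_of_le_sum (h.trans_eq hx)
  obtain ⟨h0, hpv⟩ := hp.le_of_le_nsmul hpv
  obtain ⟨z, hz⟩ := le_iff_exists_add.1
    (Finsupp.single_le_iff.2 (Nat.one_le_iff_ne_zero.2 h0) : Finsupp.single v 1 ≤ x)
  exact ⟨v, z, hz, hpv⟩

theorem IsPrimeElem.exists_single_of_eq {V : Type} {p : M} (hp : IsPrimeElem p)
    (θ : (V →₀ ℕ) →+ M) {x : V →₀ ℕ} (h : θ x = p) :
    ∃ v z, x = Finsupp.single v 1 + z ∧ θ (Finsupp.single v 1) = p ∧ p + θ z = p := by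
  obtain ⟨v, z, rfl, hpv⟩ := hp.exists_single_of_le θ h.ge
  rw [map_add] at h
  have hv : θ (Finsupp.single v 1) = p := le_antisymm (h ▸ le_self_add) hpv
  exact ⟨v, z, rfl, hv, by rw [← hv, h, hv]⟩

/-- In a graph monoid, a free prime cannot have two distinct free primes in its lower cover. -/
theorem eq_of_inLowerCover_of_addEquiv (href : IsRefinement M)
    (hgen : AddSubmonoid.closure {p : M | IsPrimeElem p} = ⊤) {G : RowFiniteGraph}
    (φ : M ≃+ graphMonoid G) {p q q' : M} (hp : IsPrimeElem p) (hfree : IsFreeElem p)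
    (hpq : InLowerCover p q) (hpq' : InLowerCover p q') (hq : IsFreeElem q)
    (hq' : IsFreeElem q') : q = q' := by
  by_contra hne
  let θ : (G.V →₀ ℕ) →+ M := (φ.symm : graphMonoid G →+ M).comp (toGraphMonoid G)
  have hθ : ∀ x y, θ x = θ y → Relation.Join (Relation.ReflTransGen (Reduces G)) x y :=
    fun x y h => join_reduces_of_mk_eq (φ.symm.injective h)
  have hsurj : Function.Surjective θ := φ.symm.surjective.comp (toGraphMonoid_surjective G)
  have hout : ∀ v, (∃ e : G.E, G.s e = v) → θ (Finsupp.single v 1) = θ (outSum G v) :=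
    fun v hv => congrArg φ.symm (toGraphMonoid_single hv)
  have hnext : ∀ v : G.V, ∃ (w : G.V) (z : G.V →₀ ℕ), θ (Finsupp.single v 1) = p →
      θ (Finsupp.single w 1) = p ∧ p + θ z = p ∧
        ((∃ e : G.E, G.s e = v) → outSum G v = Finsupp.single w 1 + z) := by
    intro v
    by_cases hv : (∃ e : G.E, G.s e = v) ∧ θ (Finsupp.single v 1) = p
    · obtain ⟨w, z, hwz, hw, hz⟩ := hp.exists_single_of_eq θ ((hout v hv.1).symm.trans hv.2)
      exact ⟨w, z, fun _ => ⟨hw, hz, fun _ => hwz⟩⟩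
    · exact ⟨v, 0, fun h => ⟨h, by simp, fun he => absurd ⟨he, h⟩ hv⟩⟩
  choose F rem hF using hnext
  obtain ⟨x₀, hx₀⟩ := hsurj p
  obtain ⟨v, -, -, hv, -⟩ := hp.exists_single_of_eq θ hx₀
  have horb : ∀ i, θ (Finsupp.single (F^[i] v) 1) = p := by
    intro i
    induction i with
    | zero => exact hv
    | succ i ih => rw [Function.iterate_succ_apply']; exact (hF _ ih).1
  let C : M → ℕ × ℕ := fun x => (count q x, count q' x)
  obtain ⟨hqp, hqlt, hqmax⟩ := inLowerCover_iff.1 hpq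
  obtain ⟨hqp', hqlt', hqmax'⟩ := inLowerCover_iff.1 hpq'
  have hCadd : ∀ x y, p + x = p → p + y = p → C (x + y) = C x + C y := fun x y hx hy =>
    Prod.ext
      (count_add href hqp hq (exists_hasCount hgen hfree hpq x hx)
        (exists_hasCount hgen hfree hpq y hy))
      (count_add href hqp' hq' (exists_hasCount hgen hfree hpq' x hx)
        (exists_hasCount hgen hfree hpq' y hy))
  have hCq : C q = (1, 0) := Prod.ext (count_self href hqp hq)
    (count_eq_zero href hqp' hq' fun h => hqmax' q hqp (lt_of_le_of_ne h (Ne.symm hne)) hqlt)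
  have hCq' : C q' = (0, 1) := Prod.ext
    (count_eq_zero href hqp hq fun h => hqmax q' hqp' (lt_of_le_of_ne h hne) hqlt')
    (count_self href hqp' hq')
  have hpabs : ∀ {x}, p ≤ x → p + x ≠ p := fun {x} hx h => hfree.add_self_ne
    (le_antisymm ((add_le_add_right hx p).trans h.le) le_self_add)
  let d : G.V → ℕ × ℕ := fun w => C (θ (rem w))
  have hinv : ∀ (x y : G.V →₀ ℕ), p + θ x = p →
      Relation.ReflTransGen (Reduces G) (Finsupp.single v 1 + x) y →
      ∃ i z, y = Finsupp.single (F^[i] v) 1 + z ∧ p + θ z = p ∧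
        C (θ z) = C (θ x) + ∑ j ∈ Finset.range i, d (F^[j] v) := by
    intro x y hx h
    induction h with
    | refl => exact ⟨0, x, rfl, hx, by simp⟩
    | tail _ hbc ih =>
      obtain ⟨i, z, rfl, hz, hC⟩ := ih
      obtain ⟨w, t, hw, h, rfl⟩ := hbc
      rcases single_add_eq_single_add h with ⟨rfl, rfl⟩ | ⟨-, u, rfl, rfl⟩
      · obtain ⟨-, hrem, hsum⟩ := hF _ (horb i)
        refine ⟨i + 1, rem (F^[i] v) + z, ?_, ?_, ?_⟩
        · rw [hsum hw, Function.iterate_succ_apply', add_assoc]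
        · rw [map_add, ← add_assoc, hrem, hz]
        · rw [map_add, hCadd _ _ hrem hz, hC, Finset.sum_range_succ, add_comm, add_assoc]
      · have hw' : θ (outSum G w + u) = θ (Finsupp.single w 1 + u) := by
          rw [map_add, map_add, hout w hw]
        exact ⟨i, outSum G w + u, add_left_comm _ _ _, by rw [hw', hz], by rw [hw', hC]⟩
  have hret : ∀ x, x < p → ∃ i k, F^[i] v = F^[k] v ∧
      ∑ j ∈ Finset.range i, d (F^[j] v) = C x + ∑ j ∈ Finset.range k, d (F^[j] v) := by
    intro x hx
    have hpx := hp.add_eq_self_of_lt hx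
    obtain ⟨x, rfl⟩ := hsurj x
    obtain ⟨y, h1, h2⟩ := hθ (Finsupp.single v 1 + 0) (Finsupp.single v 1 + x)
      (by rw [map_add, map_add, hv, hpx, map_zero, add_zero])
    obtain ⟨i, z, rfl, hz, hCz⟩ := hinv 0 y (by simp) h1
    obtain ⟨k, z', h, hz', hCz'⟩ := hinv x _ hpx h2
    rcases single_add_eq_single_add h with ⟨hik, rfl⟩ | ⟨-, u, rfl, rfl⟩
    · refine ⟨i, k, hik, ?_⟩
      have hC0 : C (θ 0) = 0 := by
        rw [map_zero]
        exact Prod.ext (count_eq_zero href hqp hq hqp.not_le_zero)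
          (count_eq_zero href hqp' hq' hqp'.not_le_zero)
      rw [← hCz', hCz, hC0, zero_add]
    · exact absurd hz (hpabs (by rw [map_add, horb]; exact le_self_add))
  obtain ⟨i, k, hik, h⟩ := hret q hqlt
  obtain ⟨i', k', hik', h'⟩ := hret q' hqlt'
  exact not_return_both F d v hik hik' (hCq ▸ h) (hCq' ▸ h')

end Necessity

section Presentation

variable {M : Type} [AddCommMonoid M] [PartialOrder M]

theorem add_nsmul_eq_self {N : Type} [AddCommMonoid N] {x y : N} (h : x + y = x) (n : ℕ) :
    x + n • y = x := by
  induction n with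
  | zero => simp
  | succ n ih => rw [succ_nsmul, ← add_assoc, ih, h]

theorem add_sum_eq_self {N ι : Type} [AddCommMonoid N] {x : N} {s : Finset ι} {f : ι → N}
    (h : ∀ i ∈ s, x + f i = x) : x + ∑ i ∈ s, f i = x := by
  classical
  induction s using Finset.induction_on with
  | empty => simp
  | insert a s ha ih =>
    rw [Finset.sum_insert ha, ← add_assoc, h a (by simp), ih fun i hi => h i (by simp [hi])]

theorem add_eq_self_of_mem {N ι : Type} [AddCommMonoid N] {s : Finset ι} {f : ι → N} {i : ι}
    (hi : i ∈ s) {y : N} (h : f i + y = f i) : ∑ j ∈ s, f j + y = ∑ j ∈ s, f j := by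
  classical
  rw [← Finset.add_sum_erase s f hi, add_right_comm, h]

theorem nsmul_eq_self {N : Type} [AddCommMonoid N] {x : N} (h : x + x = x) {n : ℕ} (hn : n ≠ 0) :
    n • x = x := by
  obtain ⟨m, rfl⟩ := Nat.exists_eq_succ_of_ne_zero hn
  rw [Nat.succ_eq_add_one, succ_nsmul', add_nsmul_eq_self h]

variable [Fintype {p : M // IsPrimeElem p}]

open Classical in
/-- The maximal primes below `m`. -/
noncomputable def maxPrimes (m : M) : Finset {p : M // IsPrimeElem p} :=
  Finset.univ.filter fun p => Maximal (fun r : {p : M // IsPrimeElem p} => (r : M) ≤ m) p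

theorem mem_maxPrimes {m : M} {p : {p : M // IsPrimeElem p}} :
    p ∈ maxPrimes m ↔ Maximal (fun r : {p : M // IsPrimeElem p} => (r : M) ≤ m) p := by
  simp [maxPrimes]

variable [CanonicallyOrderedAdd M]

theorem le_sum_of_ne_zero (x : {p : M // IsPrimeElem p} → ℕ) {p : {p : M // IsPrimeElem p}}
    (h : x p ≠ 0) : (p : M) ≤ ∑ r, x r • (r : M) := calc
  (p : M) = 1 • (p : M) := (one_nsmul _).symm
  _ ≤ x p • (p : M) := nsmul_le_nsmul_left zero_le (Nat.one_le_iff_ne_zero.2 h)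
  _ ≤ ∑ r, x r • (r : M) :=
    Finset.single_le_sum (f := fun r => x r • (r : M)) (fun _ _ => zero_le) (Finset.mem_univ p)

theorem ne_zero_of_mem_maxPrimes {x : {p : M // IsPrimeElem p} → ℕ} {p : {p : M // IsPrimeElem p}}
    (h : p ∈ maxPrimes (∑ r, x r • (r : M))) : x p ≠ 0 := by
  rw [mem_maxPrimes] at h
  obtain ⟨r, -, hr⟩ := p.2.le_of_le_sum h.1
  obtain ⟨h0, hr⟩ := p.2.le_of_le_nsmul hr
  have : r = p := le_antisymm (h.2 (le_sum_of_ne_zero x h0) hr) hr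
  exact this ▸ h0

theorem le_of_mem_maxPrimes (href : IsRefinement M) {x y : {p : M // IsPrimeElem p} → ℕ}
    (hxy : ∑ r, x r • (r : M) = ∑ r, y r • (r : M)) {p : {p : M // IsPrimeElem p}}
    (h : p ∈ maxPrimes (∑ r, x r • (r : M))) (hfree : IsFreeElem (p : M)) : x p ≤ y p := by
  classical
  rw [hxy, mem_maxPrimes] at h
  refine p.2.le_of_nsmul_le href hfree (y := ∑ r ∈ Finset.univ.erase p, y r • (r : M)) ?_ ?_
  · rw [Finset.add_sum_erase Finset.univ (fun r => y r • (r : M)) (Finset.mem_univ p), ← hxy]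
    exact Finset.single_le_sum (f := fun r => x r • (r : M)) (fun _ _ => zero_le)
      (Finset.mem_univ p)
  · intro hle
    obtain ⟨r, hr, hpr⟩ := p.2.le_of_le_sum hle
    obtain ⟨h0, hpr⟩ := p.2.le_of_le_nsmul hpr
    exact Finset.ne_of_mem_erase hr (le_antisymm (h.2 (le_sum_of_ne_zero y h0) hpr) hpr)

variable {N : Type} [AddCommMonoid N] {a : {p : M // IsPrimeElem p} → N}

theorem sum_nsmul_eq_sum_maxPrimes (habs : ∀ p q, q < p → a p + a q = a p)
    (x : {p : M // IsPrimeElem p} → ℕ) :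
    ∑ p, x p • a p = ∑ p ∈ maxPrimes (∑ r, x r • (r : M)), x p • a p := by
  classical
  rw [← Finset.sum_add_sum_compl (maxPrimes (∑ r, x r • (r : M)))]
  refine add_sum_eq_self fun p hp => ?_
  by_cases h0 : x p = 0
  · simp [h0]
  refine add_nsmul_eq_self ?_ _
  obtain ⟨t, hpt, ht⟩ := (Set.toFinite
    {r : {p : M // IsPrimeElem p} | (r : M) ≤ ∑ r, x r • (r : M)}).exists_le_maximal
    (le_sum_of_ne_zero x h0)
  have ht' : t ∈ maxPrimes (∑ r, x r • (r : M)) := mem_maxPrimes.2 ht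
  refine add_eq_self_of_mem ht' ?_
  obtain ⟨n, hn⟩ := Nat.exists_eq_succ_of_ne_zero (ne_zero_of_mem_maxPrimes ht')
  have hlt : p < t := lt_of_le_of_ne hpt fun h => Finset.mem_compl.1 hp (h ▸ ht')
  rw [hn, Nat.succ_eq_add_one, succ_nsmul, add_assoc, habs t p hlt]

/-- A finitely generated antisymmetric refinement monoid is presented by its primes, subject to
the relations `p + q = p` for `q < p` and `p + p = p` for `p` idempotent. -/
theorem sum_nsmul_eq_of_sum_nsmul_eq (href : IsRefinement M)
    (habs : ∀ p q, q < p → a p + a q = a p)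
    (hidem : ∀ p : {p : M // IsPrimeElem p}, (p : M) + p = p → a p + a p = a p)
    {x y : {p : M // IsPrimeElem p} → ℕ} (hxy : ∑ r, x r • (r : M) = ∑ r, y r • (r : M)) :
    ∑ p, x p • a p = ∑ p, y p • a p := by
  rw [sum_nsmul_eq_sum_maxPrimes habs x, sum_nsmul_eq_sum_maxPrimes habs y, ← hxy]
  refine Finset.sum_congr rfl fun p hp => ?_
  have hpy : p ∈ maxPrimes (∑ r, y r • (r : M)) := hxy ▸ hp
  rcases p.2.free_or_idem href with hfree | h
  · rw [le_antisymm (le_of_mem_maxPrimes href hxy hp hfree)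
      (le_of_mem_maxPrimes href hxy.symm hpy hfree)]
  · rw [nsmul_eq_self (hidem p h) (ne_zero_of_mem_maxPrimes hp),
      nsmul_eq_self (hidem p h) (ne_zero_of_mem_maxPrimes hpy)]

end Presentation

section ListGraph

variable {V : Type} [Countable V] (out : V → List V)

/-- The graph in which the edges emitted by `v` are listed, by their ranges, in `out v`. -/
abbrev listGraph : RowFiniteGraph where
  V := V
  E := Σ v, Fin (out v).length
  countableV := inferInstance
  countableE := inferInstance
  s := Sigma.fst
  r := fun e => (out e.1).get e.2
  rowFinite := fun v => (Set.finite_range (Sigma.mk v)).subset fun e he => by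
    obtain ⟨w, i⟩ := e
    obtain rfl : w = v := he
    exact ⟨i, rfl⟩

theorem outSum_listGraph (v : V) :
    outSum (listGraph out) v = ((out v).map fun w => Finsupp.single w 1).sum := by
  have h : ((listGraph out).rowFinite v).toFinset =
      Finset.univ.map (Function.Embedding.sigmaMk (β := fun v => Fin (out v).length) v) := by
    ext e
    simp only [Set.Finite.mem_toFinset, Set.mem_ofPred_eq, Finset.mem_map, Finset.mem_univ,
      true_and]
    constructor
    · obtain ⟨w, i⟩ := e
      intro he
      obtain rfl : w = v := he
      exact ⟨i, rfl⟩
    · rintro ⟨i, rfl⟩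
      rfl
  rw [outSum, h, Finset.sum_map, ← List.sum_ofFn]
  congr 1
  apply List.ext_get
  · simp
  · intro n _ _
    simp
    rfl

variable {out}

theorem exists_edge_listGraph {v : V} (h : out v ≠ []) :
    ∃ e : (listGraph out).E, (listGraph out).s e = v :=
  ⟨⟨v, ⟨0, List.length_pos_iff.2 h⟩⟩, rfl⟩

theorem ne_nil_of_edge_listGraph {v : V} (h : ∃ e : (listGraph out).E, (listGraph out).s e = v) :
    out v ≠ [] := by
  obtain ⟨⟨w, i⟩, rfl⟩ := h
  exact List.length_pos_iff.1 i.pos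

/-- The generators of the monoid of a `listGraph`. -/
noncomputable def gen (out : V → List V) (v : V) : graphMonoid (listGraph out) :=
  toGraphMonoid (listGraph out) (Finsupp.single v 1)

theorem gen_eq {v : V} (h : out v ≠ []) : gen out v = ((out v).map (gen out)).sum := by
  refine (toGraphMonoid_single (G := listGraph out) (exists_edge_listGraph h)).trans ?_
  rw [outSum_listGraph]
  refine (map_list_sum (toGraphMonoid (listGraph out)) _).trans ?_
  rw [List.map_map]
  rfl

/-- The universal property of the monoid of a `listGraph`. -/
theorem exists_hom_listGraph {N : Type} [AddCommMonoid N] (f : V → N)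
    (hf : ∀ v, out v ≠ [] → f v = ((out v).map f).sum) :
    ∃ χ : graphMonoid (listGraph out) →+ N, ∀ v, χ (gen out v) = f v := by
  let F : ((listGraph out).V →₀ ℕ) →+ N := Finsupp.liftAddHom fun v => multiplesHom N (f v)
  have hF : ∀ v : V, F (Finsupp.single v 1) = f v := fun v => by
    refine (Finsupp.liftAddHom_apply_single _ v 1).trans ?_
    simp
  have hle : addConGen (graphRel (listGraph out)) ≤ AddCon.ker F := by
    refine AddCon.addConGen_le.2 ?_
    rintro _ _ ⟨v, hv, rfl, rfl⟩
    change F (Finsupp.single v 1) = F (outSum (listGraph out) v)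
    rw [hF, outSum_listGraph, map_list_sum, List.map_map, hf v (ne_nil_of_edge_listGraph hv)]
    exact congrArg List.sum (List.map_congr_left fun w _ => (hF w).symm)
  exact ⟨AddCon.lift _ F hle, hF⟩

end ListGraph

section Sufficiency

theorem absorbs_of_recurrent {N : Type} [AddCommMonoid N] {α β τ : ℕ → N}
    (hα : ∀ i, α i = α i + (α i + β i + α (i + 1)))
    (hβ : ∀ i, β i = β i + τ i + (α i + β i + α (i + 1)))
    {x : N} (hx : ∀ i, ∃ j, i ≤ j ∧ τ j = x) (i : ℕ) : α i + x = α i ∧ β i + x = β i := by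
  set S : ℕ → N := fun i => α i + β i + α (i + 1) with hS
  have hidem : ∀ i, S i + S i = S i := fun i => calc
    S i + S i = (α i + S i) + (β i + α (i + 1)) := by simp only [hS]; abel
    _ = S i := by rw [← hα i]; simp only [hS]; abel
  have hτ : ∀ i, S i + τ i = S i := fun i => calc
    S i + τ i = S i + S i + τ i := by rw [hidem]
    _ = α i + (β i + τ i + S i) + α (i + 1) := by simp only [hS]; abel
    _ = S i := by rw [← hβ i]
  have hsucc : ∀ i, S i + S (i + 1) = S i := fun i => calc
    S i + S (i + 1) = α i + β i + (α (i + 1) + S (i + 1)) := by simp only [hS]; abel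
    _ = S i := by rw [← hα (i + 1)]
  have hle : ∀ i n, S i + S (i + n) = S i := by
    intro i n
    induction n with
    | zero => exact hidem i
    | succ n ih => rw [← ih, add_assoc, ← add_assoc i, hsucc]
  obtain ⟨j, hij, rfl⟩ := hx i
  obtain ⟨n, rfl⟩ := Nat.exists_eq_add_of_le hij
  have hSx : S i + τ (i + n) = S i := by
    conv_lhs => rw [← hle i n, add_assoc, hτ]
    exact hle i n
  refine ⟨?_, ?_⟩
  · rw [hα i, add_assoc, hSx]
  · rw [hβ i, add_assoc, hSx]

/-- If `x` absorbs a finite sum all of whose terms but one are idempotent, it absorbs each term. -/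
theorem add_eq_self_of_add_sum_eq_self {N ι : Type} [AddCommMonoid N] {x : N} {s : Finset ι}
    {f : ι → N} (h : x + ∑ i ∈ s, f i = x)
    (hf : ∀ i ∈ s, ∀ j ∈ s, i ≠ j → f i + f i = f i ∨ f j + f j = f j) {i : ι} (hi : i ∈ s) :
    x + f i = x := by
  classical
  have key : ∀ j ∈ s, f j + f j = f j → x + f j = x := by
    intro j hj hjj
    conv_lhs => rw [← h, add_assoc, add_eq_self_of_mem hj hjj]
    exact h
  by_cases hii : f i + f i = f i
  · exact key i hi hii
  have hrest : x + ∑ j ∈ s.erase i, f j = x := add_sum_eq_self fun j hj =>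
    key j (Finset.mem_of_mem_erase hj) ((hf i hi j (Finset.mem_of_mem_erase hj)
      (Finset.ne_of_mem_erase hj).symm).resolve_left hii)
  rw [← Finset.add_sum_erase s f hi, add_left_comm, hrest] at h
  rw [add_comm, h]

theorem exists_recurrent_enumeration {W : Type} [Countable W] (s : Set W) (hs : s.Nonempty) :
    ∃ t : ℕ → W, (∀ i, t i ∈ s) ∧ ∀ w ∈ s, ∀ i, ∃ j, i ≤ j ∧ t j = w := by
  have := hs.to_subtype
  obtain ⟨f, hf⟩ := exists_surjective_nat s
  refine ⟨fun i => f i.unpair.1, fun i => (f i.unpair.1).2, fun w hw i => ?_⟩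
  obtain ⟨k, hk⟩ := hf ⟨w, hw⟩
  exact ⟨Nat.pair k i, Nat.right_le_pair k i, by simp [hk]⟩

variable {M : Type} [AddCommMonoid M] [PartialOrder M]

open Classical in
/-- The outgoing edges of the graph representing a monoid with the given primes: a free prime
emits a loop and one edge to each prime of its lower cover, while the vertices over an idempotent
prime `p` emit enough edges to reach each vertex over a prime `q ≤ p` (listed in `t p`). -/
noncomputable def primeOut [Fintype {p : M // IsPrimeElem p}]
    (t : {p : M // IsPrimeElem p} → ℕ → {p : M // IsPrimeElem p} × ℕ × Bool) :
    {p : M // IsPrimeElem p} × ℕ × Bool → List ({p : M // IsPrimeElem p} × ℕ × Bool) :=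
  fun v =>
    if (v.1 : M) + v.1 = v.1 then
      (if v.2.2 then [(v.1, v.2.1, true), t v.1 v.2.1] else [(v.1, v.2.1, false)]) ++
        [(v.1, v.2.1, false), (v.1, v.2.1, true), (v.1, v.2.1 + 1, false)]
    else
      (v.1, 0, false) ::
        (Finset.univ.filter fun q : {p : M // IsPrimeElem p} =>
          InLowerCover (v.1 : M) q).toList.map fun q => (q, 0, false)

variable [CanonicallyOrderedAdd M]

/-- If the lower cover of each free prime contains at most one free prime, the monoid is a graph
monoid. -/
theorem isGraphMonoid_of_lowerCover [Fintype {p : M // IsPrimeElem p}] (href : IsRefinement M)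
    (hgen : AddSubmonoid.closure {p : M | IsPrimeElem p} = ⊤)
    (h : ∀ p : M, IsPrimeElem p → IsFreeElem p → ∀ q q' : M, InLowerCover p q →
      InLowerCover p q' → IsFreeElem q → IsFreeElem q' → q = q') : IsGraphMonoid M := by
  classical
  have henum := fun p : {p : M // IsPrimeElem p} =>
    exists_recurrent_enumeration {v : {p : M // IsPrimeElem p} × ℕ × Bool | v.1 ≤ p}
      ⟨(p, 0, false), le_refl p⟩
  have : Countable {p : M // IsPrimeElem p} := Finite.to_countable
  choose t ht htrec using henum
  have hne : ∀ v, primeOut t v ≠ [] := fun v => by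
    unfold primeOut; split_ifs <;> simp
  let g := gen (primeOut t)
  have hfree : ∀ v, ¬ (v.1 : M) + v.1 = v.1 → g v = g (v.1, 0, false) +
      ∑ q ∈ Finset.univ.filter fun q : {p : M // IsPrimeElem p} => InLowerCover (v.1 : M) q,
        g (q, 0, false) := by
    intro v hv
    refine (gen_eq (hne v)).trans ?_
    simp only [primeOut, if_neg hv, List.map_cons, List.sum_cons, List.map_map]
    rw [← Finset.sum_map_toList]
    rfl
  have habsreg : ∀ p : {p : M // IsPrimeElem p}, (p : M) + p = p → ∀ i w, w.1 ≤ p →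
      g (p, i, false) + g w = g (p, i, false) ∧ g (p, i, true) + g w = g (p, i, true) := by
    intro p hp i w hw
    refine absorbs_of_recurrent (α := fun i => g (p, i, false)) (β := fun i => g (p, i, true))
      (τ := fun i => g (t p i)) ?_ ?_ ?_ i
    · intro i
      refine (gen_eq (hne _)).trans ?_
      simp [primeOut, hp, g, add_assoc]
    · intro i
      refine (gen_eq (hne _)).trans ?_
      simp [primeOut, hp, g, add_assoc]
    · intro i
      obtain ⟨j, hij, hj⟩ := htrec p w hw i
      exact ⟨j, hij, by simp only [hj]⟩
  have hcopy : ∀ v, g v = g (v.1, 0, false) := by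
    rintro ⟨p, i, b⟩
    by_cases hp : (p : M) + p = p
    · have h1 := (habsreg p hp 0 (p, i, b) le_rfl).1
      cases b
      · have h2 := (habsreg p hp i (p, 0, false) le_rfl).1
        rw [← h2, add_comm, h1]
      · have h2 := (habsreg p hp i (p, 0, false) le_rfl).2
        rw [← h2, add_comm, h1]
    · exact (hfree (p, i, b) hp).trans (hfree (p, 0, false) hp).symm
  let a : {p : M // IsPrimeElem p} → graphMonoid (listGraph (primeOut t)) :=
    fun p => g (p, 0, false)
  have hidem : ∀ p : {p : M // IsPrimeElem p}, (p : M) + p = p → a p + a p = a p :=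
    fun p hp => (habsreg p hp 0 (p, 0, false) le_rfl).1
  have habs : ∀ p q, q < p → a p + a q = a p := by
    intro p
    induction p using WellFoundedLT.induction with
    | ind p ih =>
      intro q hqp
      by_cases hp : (p : M) + p = p
      · exact (habsreg p hp 0 (q, 0, false) hqp.le).1
      have hcover : ∀ r : {p : M // IsPrimeElem p}, InLowerCover (p : M) r → a p + a r = a p := by
        intro r hr
        refine add_eq_self_of_add_sum_eq_self (hfree (p, 0, false) hp).symm ?_ (by simpa using hr)
        intro r hr s hs hrs
        by_contra! hcon
        refine hrs (Subtype.ext (h p p.2 ((p.2.free_or_idem href).resolve_right hp) r s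
          (by simpa using hr) (by simpa using hs)
          ((r.2.free_or_idem href).resolve_right fun h => hcon.1 (hidem r h))
          ((s.2.free_or_idem href).resolve_right fun h => hcon.2 (hidem s h))))
      obtain ⟨r, hqr, hr⟩ := (Set.toFinite
        {r : {p : M // IsPrimeElem p} | r < p}).exists_le_maximal hqp
      have hrp : InLowerCover (p : M) r := inLowerCover_iff.2
        ⟨r.2, hr.1, fun s hs hrs hsp => (hr.not_prop_of_gt (y := ⟨s, hs⟩) hrs) hsp⟩
      rcases hqr.eq_or_lt with rfl | hlt
      · exact hcover q hrp
      · rw [← hcover r hrp, add_assoc, ih r hr.1 q hlt]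
  have hle : ∀ p q : {p : M // IsPrimeElem p}, q ≤ p → (p : M) + p = p → (p : M) + q = p := by
    intro p q hqp hp
    rcases hqp.eq_or_lt with rfl | hlt
    · exact hp
    · exact p.2.add_eq_self_of_lt hlt
  obtain ⟨χ, hχ⟩ := exists_hom_listGraph (out := primeOut t) (fun v => (v.1 : M)) (by
    intro v _
    by_cases hv : (v.1 : M) + v.1 = v.1
    · obtain ⟨p, i, b⟩ := v
      have := hle p (t p i).1 (ht p i) hv
      cases b
      · simp [primeOut, hv]
      · simp only [primeOut] at hv ⊢
        simp [hv, ← add_assoc, this]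
    · simp only [primeOut, if_neg hv, List.map_cons, List.sum_cons, List.map_map]
      refine Eq.symm ((congrArg _ (Finset.sum_map_toList _ _)).trans (add_sum_eq_self ?_))
      intro q hq
      exact v.1.2.add_eq_self_of_lt (inLowerCover_iff.1 (Finset.mem_filter.1 hq).2).2.1)
  have hspan : ∀ y, ∃ x : {p : M // IsPrimeElem p} → ℕ, y = ∑ p, x p • a p := by
    intro y
    obtain ⟨f, rfl⟩ := toGraphMonoid_surjective _ y
    induction f using Finsupp.induction_linear with
    | zero => exact ⟨0, by simp⟩
    | add f f' hf hf' =>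
      obtain ⟨x, hx⟩ := hf
      obtain ⟨x', hx'⟩ := hf'
      exact ⟨x + x', by simp [hx, hx', add_nsmul, Finset.sum_add_distrib]⟩
    | single v n =>
      refine ⟨Pi.single v.1 n, ?_⟩
      rw [Finset.sum_eq_single v.1 (fun b _ hb => by simp [hb]) (by simp), Pi.single_eq_same]
      rw [show a v.1 = g v from (hcopy v).symm]
      change _ = n • toGraphMonoid _ _
      rw [← map_nsmul, Finsupp.smul_single_one]
  have hχa : ∀ p, χ (a p) = p := fun p => hχ (p, 0, false)
  have hinj : Function.Injective χ := by
    intro y z hyz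
    obtain ⟨x, rfl⟩ := hspan y
    obtain ⟨x', rfl⟩ := hspan z
    simp only [map_sum, map_nsmul, hχa] at hyz
    exact sum_nsmul_eq_of_sum_nsmul_eq href habs hidem hyz
  have hsurj : Function.Surjective χ := by
    rw [← AddMonoidHom.mrange_eq_top, eq_top_iff, ← hgen, AddSubmonoid.closure_le]
    exact fun p hp => ⟨a ⟨p, hp⟩, hχa ⟨p, hp⟩⟩
  exact ⟨_, ⟨(AddEquiv.ofBijective χ ⟨hinj, hsurj⟩).symm⟩⟩

end Sufficiency

/-- A finitely generated antisymmetric refinement monoid `M` is a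
graph monoid if and only if for every free prime `p` of `M` the lower cover of `p`
in the poset of primes of `M` contains at most one free prime. -/
theorem antisymmetric_isGraphMonoid_iff (M : Type) [AddCommMonoid M] [AddMonoid.FG M]
    (hanti : ∀ x y : M, algLE x y → algLE y x → x = y)
    (href : IsRefinement M) :
    IsGraphMonoid M ↔
      ∀ p : M, IsPrimeElem p → IsFreeElem p →
        ∀ q q' : M, InLowerCover p q → InLowerCover p q' →
          IsFreeElem q → IsFreeElem q' → q = q' := by
  let _ := algPartialOrder hanti
  have := canonicallyOrderedAdd_algPartialOrder hanti
  have := wellFoundedLT_of_fg (M := M)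
  have hgen := closure_isPrimeElem_eq_top href
  have : Fintype {p : M // IsPrimeElem p} := (finite_isPrimeElem (M := M)).fintype
  refine ⟨?_, isGraphMonoid_of_lowerCover href hgen⟩
  rintro ⟨G, ⟨φ⟩⟩ p hp hfree q q' hpq hpq' hq hq'
  exact eq_of_inLowerCover_of_addEquiv href hgen φ hp hfree hpq hpq' hq hq'

end ArPardo
end

section
/- Let E be a row-finite directed graph and let H be a hereditary subset of E⁰. Then the order-ideal I(H) of M(E) generated by {a_v : v ∈ H} coincides with the submonoid of M(E) generated by {a_v : v ∈ H}: every element of I(H) is a finite sum of elements a_v with v ∈ H. -/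
namespace ArPardo

/-- The saturation of a set `H` of vertices: the smallest set containing `H` and every vertex
that emits edges, all of them into the set. -/
inductive Saturation (G : RowFiniteGraph) (H : Set G.V) : G.V → Prop
  | of_mem (v : G.V) : v ∈ H → Saturation G H v
  | of_edges (v : G.V) : (∃ e : G.E, G.s e = v) →
      (∀ e : G.E, G.s e = v → Saturation G H (G.r e)) → Saturation G H v

/-- The saturation of a hereditary set is hereditary. -/
theorem Saturation.range {G : RowFiniteGraph} {H : Set G.V}
    (hher : ∀ e : G.E, G.s e ∈ H → G.r e ∈ H) {e : G.E} (h : Saturation G H (G.s e)) :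
    Saturation G H (G.r e) := by
  generalize hv : G.s e = v at h
  cases h with
  | of_mem _ hm => exact .of_mem _ (hher e (hv ▸ hm))
  | of_edges _ _ hr => exact hr e hv

/-- The congruence on the free commutative monoid identifying any two elements whose supports
are both contained, or both not contained, in the set defined by `P`. -/
def supportCon {V : Type} (P : V → Prop) : AddCon (V →₀ ℕ) where
  r x y := (∀ v, x v ≠ 0 → P v) ↔ (∀ v, y v ≠ 0 → P v)
  iseqv := ⟨fun _ => Iff.rfl, Iff.symm, Iff.trans⟩
  add' {w x y z} hwx hyz := by
    have key (a b : V →₀ ℕ) : (∀ v, (a + b) v ≠ 0 → P v) ↔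
        (∀ v, a v ≠ 0 → P v) ∧ ∀ v, b v ≠ 0 → P v := by
      rw [← forall_and]
      refine forall_congr' fun v => ?_
      rw [Finsupp.add_apply, Ne, add_eq_zero]
      tauto
    rw [key, key, hwx, hyz]

/-- The set of elements supported in the saturation of a hereditary set is invariant under the
congruence defining the graph monoid. -/
theorem addConGen_graphRel_le_supportCon {G : RowFiniteGraph} {H : Set G.V}
    (hher : ∀ e : G.E, G.s e ∈ H → G.r e ∈ H) :
    addConGen (graphRel G) ≤ supportCon (Saturation G H) := by
  classical
  refine AddCon.addConGen_le.2 ?_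
  rintro _ _ ⟨v, hv, rfl, rfl⟩
  have hl : (∀ w, Finsupp.single v 1 w ≠ 0 → Saturation G H w) ↔ Saturation G H v := by
    simp [Finsupp.single_apply]
  have hr : (∀ w, (∑ e ∈ (G.rowFinite v).toFinset, Finsupp.single (G.r e) 1 : G.V →₀ ℕ) w ≠ 0 →
      Saturation G H w) ↔ ∀ e, G.s e = v → Saturation G H (G.r e) := by
    simp [Finsupp.finsetSum_apply, Finsupp.single_apply]
  change (_ ↔ _)
  rw [hl, hr]
  exact ⟨fun h e he => (he ▸ h : Saturation G H (G.s e)).range hher, .of_edges v hv⟩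

/-- The defining relation of the graph monoid at a vertex emitting edges. -/
theorem vertexElem_eq_sum (G : RowFiniteGraph) {v : G.V} (hv : ∃ e : G.E, G.s e = v) :
    vertexElem G v = ∑ e ∈ (G.rowFinite v).toFinset, vertexElem G (G.r e) :=
  ((AddCon.eq _).2 (AddConGen.Rel.of _ _ ⟨v, hv, rfl, rfl⟩)).trans
    (map_sum (addConGen (graphRel G)).mk' _ _)

theorem Saturation.vertexElem_mem_closure {G : RowFiniteGraph} {H : Set G.V} {v : G.V}
    (h : Saturation G H v) :
    vertexElem G v ∈
      AddSubmonoid.closure {x : graphMonoid G | ∃ v ∈ H, x = vertexElem G v} := by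
  induction h with
  | of_mem v hv => exact AddSubmonoid.subset_closure ⟨v, hv, rfl⟩
  | of_edges v hv _ ih =>
    rw [vertexElem_eq_sum G hv]
    exact sum_mem fun e he => ih e (by simpa using he)

theorem mk_eq_sum_vertexElem (G : RowFiniteGraph) (f : G.V →₀ ℕ) :
    ((addConGen (graphRel G)).mk' f : graphMonoid G) = f.sum fun v n => n • vertexElem G v := by
  conv_lhs => rw [← f.sum_single]
  refine (map_finsuppSum (addConGen (graphRel G)).mk' _ _).trans
    (Finsupp.sum_congr fun v _ => ?_)
  rw [← Finsupp.smul_single_one]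
  exact map_nsmul (addConGen (graphRel G)).mk' (f v) (Finsupp.single v 1)

/-- Every element of the submonoid generated by the vertices in `H` is the class of an element
supported in `H`. -/
theorem exists_rep_of_mem_closure {G : RowFiniteGraph} {H : Set G.V} {x : graphMonoid G}
    (hx : x ∈ AddSubmonoid.closure {x : graphMonoid G | ∃ v ∈ H, x = vertexElem G v}) :
    ∃ f : G.V →₀ ℕ, (addConGen (graphRel G)).mk' f = x ∧ ∀ v, f v ≠ 0 → v ∈ H := by
  classical
  induction hx using AddSubmonoid.closure_induction with
  | mem x hx =>
    obtain ⟨v, hv, rfl⟩ := hx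
    exact ⟨Finsupp.single v 1, rfl, by simpa [Finsupp.single_apply] using hv⟩
  | zero => exact ⟨0, rfl, by simp⟩
  | add x y _ _ ihx ihy =>
    obtain ⟨f, rfl, hf⟩ := ihx
    obtain ⟨g, rfl, hg⟩ := ihy
    refine ⟨f + g, rfl, fun v hv => ?_⟩
    by_cases h : f v = 0
    · exact hg v (by simpa [h] using hv)
    · exact hf v h

/-- The submonoid generated by the vertices of a hereditary set is an order-ideal. -/
theorem isOrderIdeal_closure {G : RowFiniteGraph} {H : Set G.V}
    (hher : ∀ e : G.E, G.s e ∈ H → G.r e ∈ H) :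
    IsOrderIdeal (AddSubmonoid.closure {x : graphMonoid G | ∃ v ∈ H, x = vertexElem G v} :
      Set (graphMonoid G)) := by
  refine ⟨zero_mem _, fun _ _ => add_mem, ?_⟩
  rintro x _ ⟨z, rfl⟩ hxz
  obtain ⟨f, rfl⟩ := (addConGen (graphRel G)).mk'_surjective x
  obtain ⟨g, rfl⟩ := (addConGen (graphRel G)).mk'_surjective z
  obtain ⟨h, hh, hH⟩ := exists_rep_of_mem_closure hxz
  have hcon : addConGen (graphRel G) h (f + g) := (AddCon.eq _).1 hh
  have hfg : ∀ v, (f + g) v ≠ 0 → Saturation G H v :=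
    (addConGen_graphRel_le_supportCon hher hcon).1 fun v hv => .of_mem v (hH v hv)
  refine (mk_eq_sum_vertexElem G f).symm ▸ sum_mem fun v hv => nsmul_mem (Saturation.vertexElem_mem_closure (hfg v ?_)) _
  have := Finsupp.mem_support_iff.1 hv
  simp [this]

/-- For a row-finite graph `E` and a hereditary subset `H` of its
vertices, the order-ideal `I(H)` of `M(E)` generated by `{a_v : v ∈ H}` coincides
with the submonoid of `M(E)` generated by `{a_v : v ∈ H}`. -/
theorem orderIdeal_of_hereditary_eq_closure (G : RowFiniteGraph) (H : Set G.V)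
    (hher : ∀ e : G.E, G.s e ∈ H → G.r e ∈ H) :
    orderIdealGen {x : graphMonoid G | ∃ v ∈ H, x = vertexElem G v}
      = (AddSubmonoid.closure {x : graphMonoid G | ∃ v ∈ H, x = vertexElem G v}
          : Set (graphMonoid G)) := by
  refine Set.Subset.antisymm
    (Set.sInter_subset_of_mem ⟨isOrderIdeal_closure hher, AddSubmonoid.subset_closure⟩) ?_
  rintro x hx S ⟨⟨h0, hadd, -⟩, hS⟩
  induction hx using AddSubmonoid.closure_induction with
  | mem x hx => exact hS hx
  | zero => exact h0
  | add x y _ _ ihx ihy => exact hadd x y ihx ihy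

end ArPardo
end
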